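/- arXiv:2411.04145 — 4 statements merged into one kernel-verified Lean document; each statement's English description precedes it below -/
import Mathlib

section
/- Let h : ℝ² → ℝ be a smooth function whose support is contained in the open unit disk 𝔻, and let c₁, c₂ be nonzero real constants. Then for every (φ, ψ) ∈ [0, 2π) × (0, π/2), the weighted V-line transform of h satisfies V_w h(φ, ψ) = c₁ · Rh(sin ψ, φ − ψ + π/2) + c₂ · Rh(sin ψ, φ + ψ − π/2). -/
open Real MeasureTheory Set

noncomputable section

/-- The unit vector at polar angle `θ`. -/
def Phi (θ : ℝ) : ℝ × ℝ := (Real.cos θ, Real.sin θ)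

/-- Rotation of a vector by 90° counterclockwise. -/
def perp (w : ℝ × ℝ) : ℝ × ℝ := (-w.2, w.1)

/-- Euclidean dot product on `ℝ × ℝ`. -/
def dot (a b : ℝ × ℝ) : ℝ := a.1 * b.1 + a.2 * b.2

/-- The open unit disk in the plane. -/
def unitDisk : Set (ℝ × ℝ) := {x | x.1 ^ 2 + x.2 ^ 2 < 1}

/-- The closed unit disk in the plane. -/
def closedUnitDisk : Set (ℝ × ℝ) := {x | x.1 ^ 2 + x.2 ^ 2 ≤ 1}

/-- The unit circle in the plane. -/
def unitCircle : Set (ℝ × ℝ) := {x | x.1 ^ 2 + x.2 ^ 2 = 1}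

/-- The Radon transform of a scalar function. -/
def radon (h : ℝ × ℝ → ℝ) (s θ : ℝ) : ℝ :=
  ∫ t : ℝ, h (s • Phi θ + t • Phi (θ + π / 2))

/-- The weighted V-line transform of a scalar function, with weights `c₁, c₂`. -/
def Vw (c₁ c₂ : ℝ) (h : ℝ × ℝ → ℝ) (φ ψ : ℝ) : ℝ :=
  c₁ * (∫ t in Ioi (0 : ℝ), h (Phi φ + t • Phi (π + φ - ψ))) +
  c₂ * (∫ t in Ioi (0 : ℝ), h (Phi φ + t • Phi (π + φ + ψ)))

/-- The `n`-th (complex) Fourier coefficient of a function of the angular variable. -/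
def fourierCoeff' (g : ℝ → ℝ) (n : ℤ) : ℂ :=
  (1 / (2 * (π : ℂ))) * ∫ φ in (0 : ℝ)..(2 * π), (g φ : ℂ) * Complex.exp (-Complex.I * n * φ)

/-- A function supported in the open unit disk has the same integral over a ray emanating from a
boundary point and not pointing outwards as over the whole line containing it. -/
theorem setIntegral_ray_eq_integral {h : ℝ × ℝ → ℝ} (hsupp : Function.support h ⊆ unitDisk)
    {φ α : ℝ} (hα : Real.cos (φ - α) ≤ 0) :
    ∫ t in Ioi (0 : ℝ), h (Phi φ + t • Phi α) = ∫ t : ℝ, h (Phi φ + t • Phi α) := by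
  refine setIntegral_eq_integral_of_forall_compl_eq_zero fun t ht => ?_
  by_contra hne
  have hmem := hsupp hne
  simp only [unitDisk, Phi, mem_ofPred_eq, Prod.fst_add, Prod.snd_add, Prod.smul_fst,
    Prod.smul_snd, smul_eq_mul] at hmem
  rw [Real.cos_sub] at hα
  have ht' : t ≤ 0 := not_lt.mp ht
  nlinarith [mul_nonneg_of_nonpos_of_nonpos ht' hα, sq_nonneg t, Real.sin_sq_add_cos_sq φ,
    Real.sin_sq_add_cos_sq α]

theorem radon_sin_sub_add_pi_div_two (h : ℝ × ℝ → ℝ) (φ ψ : ℝ) :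
    radon h (Real.sin ψ) (φ - ψ + π / 2) = ∫ t : ℝ, h (Phi φ + t • Phi (π + φ - ψ)) := by
  rw [← integral_add_right_eq_self _ (Real.cos ψ), radon]
  congr 1 with t
  congr 1
  rw [show φ - ψ + π / 2 + π / 2 = φ - ψ + π by ring, show π + φ - ψ = φ - ψ + π by ring]
  obtain ⟨β, rfl⟩ : ∃ β, φ = β + ψ := ⟨φ - ψ, by ring⟩
  ext <;> simp [Phi, Real.cos_add, Real.sin_add] <;> ring

theorem radon_sin_add_sub_pi_div_two (h : ℝ × ℝ → ℝ) (φ ψ : ℝ) :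
    radon h (Real.sin ψ) (φ + ψ - π / 2) = ∫ t : ℝ, h (Phi φ + t • Phi (π + φ + ψ)) := by
  rw [← integral_sub_left_eq_self _ volume (Real.cos ψ), radon]
  congr 1 with t
  congr 1
  rw [show φ + ψ - π / 2 + π / 2 = φ + ψ by ring, show π + φ + ψ = φ + ψ + π by ring]
  obtain ⟨β, rfl⟩ : ∃ β, φ = β - ψ := ⟨φ + ψ, by ring⟩
  ext <;> simp [Phi, Real.cos_sub, Real.sin_sub] <;> ring

/-- the weighted V-line transform expressed through the Radon transform. -/
theorem weighted_Vline_eq_radon (h : ℝ × ℝ → ℝ) (hsm : ContDiff ℝ (⊤ : ℕ∞) h)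
    (hsupp : Function.support h ⊆ unitDisk) (c₁ c₂ : ℝ) (hc₁ : c₁ ≠ 0) (hc₂ : c₂ ≠ 0)
    (φ ψ : ℝ) (hφ : φ ∈ Ico 0 (2 * π)) (hψ : ψ ∈ Ioo 0 (π / 2)) :
    Vw c₁ c₂ h φ ψ =
      c₁ * radon h (Real.sin ψ) (φ - ψ + π / 2) + c₂ * radon h (Real.sin ψ) (φ + ψ - π / 2) := by
  have hcos : 0 ≤ Real.cos ψ :=
    Real.cos_nonneg_of_mem_Icc ⟨by linarith [hψ.1, Real.pi_pos], hψ.2.le⟩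
  have hu : Real.cos (φ - (π + φ - ψ)) ≤ 0 := by
    rw [show φ - (π + φ - ψ) = ψ - π by ring, Real.cos_sub_pi]
    linarith
  have hv : Real.cos (φ - (π + φ + ψ)) ≤ 0 := by
    rw [show φ - (π + φ + ψ) = -ψ - π by ring, Real.cos_sub_pi, Real.cos_neg]
    linarith
  rw [Vw, setIntegral_ray_eq_integral hsupp hu, setIntegral_ray_eq_integral hsupp hv,
    radon_sin_sub_add_pi_div_two, radon_sin_add_sub_pi_div_two]
end
end

section
/- Let h : ℝ² → ℝ be a smooth function whose support is contained in the open unit disk 𝔻, and let c₁, c₂ be nonzero real constants. Then for every integer n and every ψ ∈ (0, π/2), the n-th Fourier coefficient of the weighted V-line transform satisfies (V_w h)_n(ψ) = (c₁ e^{−i n (ψ − π/2)} + c₂ e^{i n (ψ − π/2)}) · (Rh)_n(sin ψ). -/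
open Real MeasureTheory Set

noncomputable section

lemma Phi_periodic : Function.Periodic Phi (2 * π) := fun θ => by
  simp [Phi]

lemma continuous_Phi : Continuous Phi := by
  unfold Phi
  fun_prop

lemma eq_zero_of_support_subset_unitDisk {h : ℝ × ℝ → ℝ}
    (hsupp : Function.support h ⊆ unitDisk) {x : ℝ × ℝ} (hx : 1 ≤ x.1 ^ 2 + x.2 ^ 2) :
    h x = 0 := by
  by_contra hne
  have hlt : x.1 ^ 2 + x.2 ^ 2 < 1 := hsupp hne
  linarith

lemma radon_periodic (h : ℝ × ℝ → ℝ) (s : ℝ) : Function.Periodic (radon h s) (2 * π) :=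
  fun θ => by
    simp only [radon, Phi_periodic θ, add_right_comm θ (2 * π), Phi_periodic (θ + π / 2)]

lemma continuous_radon {h : ℝ × ℝ → ℝ} (hc : Continuous h)
    (hsupp : Function.support h ⊆ unitDisk) (s : ℝ) : Continuous (radon h s) := by
  have hset : radon h s =
      fun θ => ∫ t in Icc (-1 : ℝ) 1, h (s • Phi θ + t • Phi (θ + π / 2)) := by
    funext θ
    refine (setIntegral_eq_integral_of_forall_compl_eq_zero fun t ht => ?_).symm
    apply eq_zero_of_support_subset_unitDisk hsupp
    have ht' : 1 < t ^ 2 := by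
      rw [one_lt_sq_iff_one_lt_abs]
      by_contra hle
      exact ht (abs_le.1 (not_lt.1 hle))
    have hnorm : (s * Real.cos θ - t * Real.sin θ) ^ 2 + (s * Real.sin θ + t * Real.cos θ) ^ 2
        = s ^ 2 + t ^ 2 := by
      linear_combination (s ^ 2 + t ^ 2) * Real.sin_sq_add_cos_sq θ
    simp only [Phi, Real.cos_add_pi_div_two, Real.sin_add_pi_div_two, Prod.smul_mk, smul_eq_mul,
      Prod.mk_add_mk]
    nlinarith [sq_nonneg s]
  rw [hset]
  refine continuous_parametric_integral_of_continuous ?_ isCompact_Icc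
  have := continuous_Phi
  fun_prop

/-- A ray that enters the disk from a boundary point carries the integral over its full line. -/
lemma integral_ray_eq_integral_line {h : ℝ × ℝ → ℝ}
    (hsupp : Function.support h ⊆ unitDisk) {φ α : ℝ} (hα : Real.cos (α - φ) ≤ 0) :
    ∫ t in Ioi (0 : ℝ), h (Phi φ + t • Phi α) = ∫ t : ℝ, h (Phi φ + t • Phi α) := by
  refine setIntegral_eq_integral_of_forall_compl_eq_zero fun t ht => ?_
  apply eq_zero_of_support_subset_unitDisk hsupp
  have ht' : t ≤ 0 := not_lt.1 ht
  have hnorm : (Real.cos φ + t * Real.cos α) ^ 2 + (Real.sin φ + t * Real.sin α) ^ 2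
      = 1 + 2 * (t * Real.cos (α - φ)) + t ^ 2 := by
    rw [Real.cos_sub]
    linear_combination Real.sin_sq_add_cos_sq φ + t ^ 2 * Real.sin_sq_add_cos_sq α
  simp only [Phi, Prod.smul_mk, smul_eq_mul, Prod.mk_add_mk]
  nlinarith [mul_nonneg_of_nonpos_of_nonpos ht' hα, sq_nonneg t]

lemma integral_line_eq_radon (h : ℝ × ℝ → ℝ) (φ θ : ℝ) :
    ∫ t : ℝ, h (Phi φ + t • Phi (θ + π / 2)) = radon h (Real.cos (φ - θ)) θ := by
  rw [radon, ← integral_sub_right_eq_self _ (Real.sin (φ - θ))]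
  congr 1
  funext t
  congr 1
  simp only [Phi, Real.cos_add_pi_div_two, Real.sin_add_pi_div_two, Prod.smul_mk, smul_eq_mul,
    Prod.mk_add_mk, Real.cos_sub, Real.sin_sub, Prod.mk.injEq]
  constructor
  · linear_combination -Real.cos φ * Real.sin_sq_add_cos_sq θ
  · linear_combination -Real.sin φ * Real.sin_sq_add_cos_sq θ

lemma integral_line_neg (h : ℝ × ℝ → ℝ) (φ α : ℝ) :
    ∫ t : ℝ, h (Phi φ + t • Phi (α + π)) = ∫ t : ℝ, h (Phi φ + t • Phi α) := by
  rw [← integral_neg_eq_self]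
  simp [Phi]

lemma Vw_eq_radon {h : ℝ × ℝ → ℝ} (hsupp : Function.support h ⊆ unitDisk) (c₁ c₂ φ : ℝ)
    {ψ : ℝ} (hψ : 0 ≤ Real.cos ψ) :
    Vw c₁ c₂ h φ ψ = c₁ * radon h (Real.sin ψ) (φ - (ψ - π / 2)) +
      c₂ * radon h (Real.sin ψ) (φ - (-(ψ - π / 2))) := by
  have hu : Real.cos (π + φ - ψ - φ) ≤ 0 := by
    rw [show π + φ - ψ - φ = π - ψ by ring, Real.cos_pi_sub]
    linarith
  have hv : Real.cos (π + φ + ψ - φ) ≤ 0 := by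
    rw [show π + φ + ψ - φ = ψ + π by ring, Real.cos_add_pi]
    linarith
  have hs : Real.cos (ψ - π / 2) = Real.sin ψ := Real.cos_sub_pi_div_two ψ
  rw [Vw, integral_ray_eq_integral_line hsupp hu, integral_ray_eq_integral_line hsupp hv,
    show π + φ - ψ = φ - (ψ - π / 2) + π / 2 by ring,
    show π + φ + ψ = φ - (-(ψ - π / 2)) + π / 2 + π by ring, integral_line_neg,
    integral_line_eq_radon, integral_line_eq_radon, sub_sub_cancel, sub_sub_cancel,
    Real.cos_neg, hs]

lemma fourierCoeff'_comp_sub {g : ℝ → ℝ} (hg : Function.Periodic g (2 * π)) (n : ℤ) (a : ℝ) :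
    fourierCoeff' (fun φ => g (φ - a)) n =
      Complex.exp (-Complex.I * n * a) * fourierCoeff' g n := by
  set F : ℝ → ℂ := fun φ => (g φ : ℂ) * Complex.exp (-Complex.I * n * φ) with hF
  have hper : Function.Periodic F (2 * π) := fun φ => by
    have hexp : Complex.exp (-Complex.I * n * ((φ + 2 * π : ℝ) : ℂ)) =
        Complex.exp (-Complex.I * n * φ) := by
      refine Complex.exp_eq_exp_iff_exists_int.2 ⟨-n, ?_⟩
      push_cast
      ring
    simp only [hF, hg φ, hexp]
  have hshift : ∀ φ : ℝ, (g (φ - a) : ℂ) * Complex.exp (-Complex.I * n * φ) =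
      Complex.exp (-Complex.I * n * a) * F (φ - a) := fun φ => by
    rw [hF, mul_left_comm, ← Complex.exp_add]
    congr 2
    push_cast
    ring
  have hint : ∫ φ in (0 : ℝ)..(2 * π), F (φ - a) = ∫ φ in (0 : ℝ)..(2 * π), F φ := by
    rw [intervalIntegral.integral_comp_sub_right, show 2 * π - a = 0 - a + 2 * π by ring,
      hper.intervalIntegral_add_eq (0 - a) 0, zero_add]
  simp only [fourierCoeff', hshift, intervalIntegral.integral_const_mul, hint]
  ring

lemma fourierCoeff'_linear_comb {f g : ℝ → ℝ} (hf : Continuous f) (hg : Continuous g)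
    (a b : ℝ) (n : ℤ) :
    fourierCoeff' (fun φ => a * f φ + b * g φ) n =
      a * fourierCoeff' f n + b * fourierCoeff' g n := by
  have hfi : Continuous fun φ : ℝ => (a : ℂ) * ((f φ : ℂ) * Complex.exp (-Complex.I * n * φ)) := by
    fun_prop
  have hgi : Continuous fun φ : ℝ => (b : ℂ) * ((g φ : ℂ) * Complex.exp (-Complex.I * n * φ)) := by
    fun_prop
  simp only [fourierCoeff', Complex.ofReal_add, Complex.ofReal_mul, add_mul, mul_assoc] at *
  rw [intervalIntegral.integral_add (hfi.intervalIntegrable _ _) (hgi.intervalIntegrable _ _),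
    intervalIntegral.integral_const_mul, intervalIntegral.integral_const_mul]
  ring

/-- Fourier coefficients of the weighted V-line transform in terms of those
of the Radon transform. -/
theorem fourierCoeff_weighted_Vline (h : ℝ × ℝ → ℝ) (hsm : ContDiff ℝ (⊤ : ℕ∞) h)
    (hsupp : Function.support h ⊆ unitDisk) (c₁ c₂ : ℝ) (hc₁ : c₁ ≠ 0) (hc₂ : c₂ ≠ 0)
    (n : ℤ) (ψ : ℝ) (hψ : ψ ∈ Ioo 0 (π / 2)) :
    fourierCoeff' (fun φ => Vw c₁ c₂ h φ ψ) n =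
      (c₁ * Complex.exp (-Complex.I * n * ((ψ - π / 2 : ℝ) : ℂ)) +
        c₂ * Complex.exp (Complex.I * n * ((ψ - π / 2 : ℝ) : ℂ))) *
        fourierCoeff' (fun φ => radon h (Real.sin ψ) φ) n := by
  have hcos : 0 ≤ Real.cos ψ :=
    Real.cos_nonneg_of_mem_Icc ⟨by linarith [hψ.1, Real.pi_pos], hψ.2.le⟩
  have hR := continuous_radon hsm.continuous hsupp (Real.sin ψ)
  have hP := radon_periodic h (Real.sin ψ)
  simp only [Vw_eq_radon hsupp _ _ _ hcos]
  have hsub (a : ℝ) : Continuous fun φ => radon h (Real.sin ψ) (φ - a) :=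
    hR.comp (continuous_sub_right a)
  rw [fourierCoeff'_linear_comb (hsub _) (hsub _),
    fourierCoeff'_comp_sub hP, fourierCoeff'_comp_sub hP, Complex.ofReal_neg,
    neg_mul Complex.I, neg_mul, neg_mul_neg]
  ring
end
end

section
/- (Cormack's inversion of the Radon transform.) Let h : ℝ² → ℝ be a smooth function whose support is contained in the open unit disk 𝔻. Then for every integer n and every r with 0 < r < 1, h_n(r) = −(1/π) ∫_r^1 (d/ds)(Rh)_n(s) · T_{|n|}(s/r) / √(s² − r²) ds, where T_k denotes the degree-k Chebyshev polynomial of the first kind evaluated as a polynomial at real arguments. -/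
open Real MeasureTheory Set

noncomputable section

/-- A parametric interval integral of a `C¹` function is differentiable in the parameter. -/
theorem hasFDerivAt_intervalIntegral_of_contDiff {E F : Type*} [NormedAddCommGroup E]
    [NormedSpace ℝ E] [FiniteDimensional ℝ E] [NormedAddCommGroup F] [NormedSpace ℝ F]
    {K : E → ℝ → F} (hK : ContDiff ℝ 1 (Function.uncurry K)) (a b : ℝ) (x₀ : E) :
    HasFDerivAt (fun x => ∫ t in a..b, K x t)
      (∫ t in a..b, (fderiv ℝ (Function.uncurry K) (x₀, t)).comp
        (ContinuousLinearMap.inl ℝ E ℝ)) x₀ := by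
  have : ProperSpace E := FiniteDimensional.proper ℝ E
  have hKc := hK.continuous
  have hd : Continuous (fun p : E × ℝ => (fderiv ℝ (Function.uncurry K) p).comp
      (ContinuousLinearMap.inl ℝ E ℝ)) :=
    (hK.continuous_fderiv one_ne_zero).clm_comp continuous_const
  have hsec : ∀ x : E, Continuous (fun t : ℝ => (x, t)) := fun x => by fun_prop
  obtain ⟨C, hC⟩ := ((isCompact_closedBall x₀ 1).prod
    (isCompact_uIcc (a := a) (b := b))).exists_bound_of_continuousOn hd.continuousOn
  refine intervalIntegral.hasFDerivAt_integral_of_dominated_of_fderiv_le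
    (F' := fun x t => (fderiv ℝ (Function.uncurry K) (x, t)).comp
        (ContinuousLinearMap.inl ℝ E ℝ)) (bound := fun _ => C)
    (Metric.closedBall_mem_nhds x₀ one_pos) ?_ ?_ ?_ ?_ ?_ ?_
  · exact .of_forall fun x => (hKc.comp (hsec x)).aestronglyMeasurable
  · exact (hKc.comp (hsec x₀)).intervalIntegrable _ _
  · exact (hd.comp (hsec x₀)).aestronglyMeasurable
  · exact .of_forall fun t ht x hx => hC (x, t) ⟨hx, Set.uIoc_subset_uIcc ht⟩
  · exact intervalIntegrable_const
  · refine .of_forall fun t _ x _ => ?_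
    exact HasFDerivAt.comp (g := Function.uncurry K) (f := fun e => (e, t)) x
      (hK.differentiable one_ne_zero (x, t)).hasFDerivAt (hasFDerivAt_prodMk_left x t)

/-- A parametric interval integral of a `Cⁿ` function is `Cⁿ` in the parameter. -/
theorem contDiff_nat_intervalIntegral {E : Type} [NormedAddCommGroup E] [NormedSpace ℝ E]
    [FiniteDimensional ℝ E] (a b : ℝ) (m : ℕ) :
    ∀ {F : Type} [NormedAddCommGroup F] [NormedSpace ℝ F] {K : E → ℝ → F},
      ContDiff ℝ m (Function.uncurry K) → ContDiff ℝ m (fun x => ∫ t in a..b, K x t) := by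
  induction m with
  | zero =>
    intro F _ _ K hK
    rw [Nat.cast_zero, contDiff_zero] at *
    exact intervalIntegral.continuous_parametric_intervalIntegral_of_continuous' hK a b
  | succ m ih =>
    intro F _ _ K hK
    push_cast at *
    refine contDiff_succ_iff_hasFDerivAt.2 ⟨_, ?_, fun x =>
      hasFDerivAt_intervalIntegral_of_contDiff (hK.of_le (by simp)) a b x⟩
    refine ih (K := fun x t => (fderiv ℝ (Function.uncurry K) (x, t)).comp
        (ContinuousLinearMap.inl ℝ E ℝ)) ?_
    exact (hK.fderiv_right le_rfl).clm_comp contDiff_const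

/-- A parametric interval integral of a smooth function is smooth in the parameter. -/
theorem contDiff_intervalIntegral {E F : Type} [NormedAddCommGroup E] [NormedSpace ℝ E]
    [FiniteDimensional ℝ E] [NormedAddCommGroup F] [NormedSpace ℝ F] {K : E → ℝ → F}
    (hK : ContDiff ℝ (⊤ : ℕ∞) (Function.uncurry K)) (a b : ℝ) :
    ContDiff ℝ (⊤ : ℕ∞) (fun x => ∫ t in a..b, K x t) :=
  contDiff_infty.2 fun m => contDiff_nat_intervalIntegral a b m (contDiff_infty.1 hK m)

/-- Differentiation under the integral sign for a one-dimensional parameter. -/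
theorem hasDerivAt_intervalIntegral_of_contDiff {F : Type*} [NormedAddCommGroup F]
    [NormedSpace ℝ F] [CompleteSpace F] {K K' : ℝ → ℝ → F}
    (hK : ContDiff ℝ 1 (Function.uncurry K))
    (hK' : ∀ x t, HasDerivAt (fun y => K y t) (K' x t) x) (a b x₀ : ℝ) :
    HasDerivAt (fun x => ∫ t in a..b, K x t) (∫ t in a..b, K' x₀ t) x₀ := by
  have h := (hasFDerivAt_intervalIntegral_of_contDiff hK a b x₀).hasDerivAt
  have hd : Continuous (fun t : ℝ => (fderiv ℝ (Function.uncurry K) (x₀, t)).comp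
      (ContinuousLinearMap.inl ℝ ℝ ℝ)) :=
    ((hK.continuous_fderiv one_ne_zero).comp
      (by fun_prop : Continuous fun t : ℝ => (x₀, t))).clm_comp continuous_const
  rw [ContinuousLinearMap.intervalIntegral_apply (hd.intervalIntegrable a b)] at h
  convert h using 3 with t
  have h1 := HasFDerivAt.comp (g := Function.uncurry K) (f := fun e => (e, t)) x₀
    (hK.differentiable one_ne_zero (x₀, t)).hasFDerivAt (hasFDerivAt_prodMk_left x₀ t)
  exact (hK' x₀ t).unique h1.hasDerivAt

/-- Rotation of the plane by the angle `α`. -/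
def planeRotation (α : ℝ) : ℝ × ℝ →L[ℝ] ℝ × ℝ :=
  (Real.cos α • ContinuousLinearMap.fst ℝ ℝ ℝ - Real.sin α • ContinuousLinearMap.snd ℝ ℝ ℝ).prod
    (Real.sin α • ContinuousLinearMap.fst ℝ ℝ ℝ + Real.cos α • ContinuousLinearMap.snd ℝ ℝ ℝ)

theorem planeRotation_apply (α : ℝ) (p : ℝ × ℝ) :
    planeRotation α p =
      (Real.cos α * p.1 - Real.sin α * p.2, Real.sin α * p.1 + Real.cos α * p.2) := rfl

theorem planeRotation_planeRotation (α β : ℝ) (p : ℝ × ℝ) :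
    planeRotation α (planeRotation β p) = planeRotation (α + β) p := by
  simp only [planeRotation_apply, Real.cos_add, Real.sin_add, Prod.mk.injEq]
  constructor <;> ring

theorem planeRotation_norm_sq (α : ℝ) (p : ℝ × ℝ) :
    (planeRotation α p).1 ^ 2 + (planeRotation α p).2 ^ 2 = p.1 ^ 2 + p.2 ^ 2 := by
  simp only [planeRotation_apply]
  linear_combination (p.1 ^ 2 + p.2 ^ 2) * Real.sin_sq_add_cos_sq α

theorem planeRotation_eq_smul_Phi (α s t : ℝ) :
    planeRotation α (s, t) = s • Phi α + t • Phi (α + π / 2) := by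
  simp only [planeRotation_apply, Phi, Real.cos_add_pi_div_two, Real.sin_add_pi_div_two,
    Prod.smul_mk, Prod.mk_add_mk, smul_eq_mul, Prod.mk.injEq]
  constructor <;> ring

/-- Smooth functions `f(ρ) e^{inφ}` (in polar coordinates) vanishing outside the unit disk. -/
structure IsAngularMode (n : ℤ) (F : ℝ × ℝ → ℂ) : Prop where
  smooth : ContDiff ℝ (⊤ : ℕ∞) F
  eq_zero : ∀ p : ℝ × ℝ, 1 < p.1 ^ 2 + p.2 ^ 2 → F p = 0
  map_rotation : ∀ α p, F (planeRotation α p) = Complex.exp (Complex.I * n * α) * F p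

/-- The integral over the chord of abscissa `s`, of a function vanishing outside the unit disk. -/
def verticalIntegral (F : ℝ × ℝ → ℂ) (s : ℝ) : ℂ := ∫ t in (-2 : ℝ)..2, F (s, t)

/-- The Wirtinger-type operator `∂₁ + i σ ∂₂`. -/
def wirtinger (σ : ℤ) (F : ℝ × ℝ → ℂ) (p : ℝ × ℝ) : ℂ :=
  fderiv ℝ F p (1, 0) + Complex.I * σ * fderiv ℝ F p (0, 1)

theorem contDiff_verticalIntegral {F : ℝ × ℝ → ℂ} (hF : ContDiff ℝ (⊤ : ℕ∞) F) :
    ContDiff ℝ (⊤ : ℕ∞) (verticalIntegral F) :=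
  contDiff_intervalIntegral (K := fun s t => F (s, t)) hF (-2) 2

theorem hasDerivAt_prodMk_fst {F : ℝ × ℝ → ℂ} (hF : Differentiable ℝ F) (s t : ℝ) :
    HasDerivAt (fun x => F (x, t)) (fderiv ℝ F (s, t) (1, 0)) s :=
  HasFDerivAt.comp_hasDerivAt (f := fun x : ℝ => (x, t)) s (hF (s, t)).hasFDerivAt
    ((hasDerivAt_id s).prodMk (hasDerivAt_const s t))

theorem hasDerivAt_prodMk_snd {F : ℝ × ℝ → ℂ} (hF : Differentiable ℝ F) (s t : ℝ) :
    HasDerivAt (fun y => F (s, y)) (fderiv ℝ F (s, t) (0, 1)) t :=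
  HasFDerivAt.comp_hasDerivAt (f := fun y : ℝ => (s, y)) t (hF (s, t)).hasFDerivAt
    ((hasDerivAt_const t s).prodMk (hasDerivAt_id t))

theorem hasDerivAt_verticalIntegral {F : ℝ × ℝ → ℂ} (hF : ContDiff ℝ (⊤ : ℕ∞) F) (s : ℝ) :
    HasDerivAt (verticalIntegral F) (∫ t in (-2 : ℝ)..2, fderiv ℝ F (s, t) (1, 0)) s :=
  hasDerivAt_intervalIntegral_of_contDiff (K := fun s t => F (s, t)) (hF.of_le (by simp))
    (K' := fun s t => fderiv ℝ F (s, t) (1, 0))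
    (fun x t => hasDerivAt_prodMk_fst (hF.differentiable (by simp)) x t) (-2) 2 s

namespace IsAngularMode

variable {n : ℤ} {F : ℝ × ℝ → ℂ}

theorem differentiable (hF : IsAngularMode n F) : Differentiable ℝ F :=
  hF.smooth.differentiable (by simp)

theorem contDiff_fderiv_apply (hF : IsAngularMode n F) (v : ℝ × ℝ) :
    ContDiff ℝ (⊤ : ℕ∞) (fun p => fderiv ℝ F p v) :=
  (hF.smooth.fderiv_right (by simp)).clm_apply contDiff_const

theorem fderiv_eq_zero (hF : IsAngularMode n F) {p : ℝ × ℝ} (hp : 1 < p.1 ^ 2 + p.2 ^ 2) :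
    fderiv ℝ F p = 0 := by
  have ho : IsOpen {q : ℝ × ℝ | 1 < q.1 ^ 2 + q.2 ^ 2} :=
    isOpen_lt (by fun_prop) (by fun_prop)
  have h : F =ᶠ[nhds p] fun _ => 0 :=
    Filter.eventually_of_mem (ho.mem_nhds hp) fun q hq => hF.eq_zero q hq
  rw [h.fderiv_eq, fderiv_const_apply]

theorem fderiv_rotation (hF : IsAngularMode n F) (α : ℝ) (p v : ℝ × ℝ) :
    fderiv ℝ F (planeRotation α p) (planeRotation α v) =
      Complex.exp (Complex.I * n * α) * fderiv ℝ F p v := by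
  have h1 : HasFDerivAt (fun q => F (planeRotation α q))
      ((fderiv ℝ F (planeRotation α p)).comp (planeRotation α)) p :=
    (hF.differentiable _).hasFDerivAt.comp p (planeRotation α).hasFDerivAt
  have h2 : HasFDerivAt (fun q => F (planeRotation α q))
      (Complex.exp (Complex.I * n * α) • fderiv ℝ F p) p := by
    simp only [hF.map_rotation]
    exact (hF.differentiable p).hasFDerivAt.const_mul _
  exact congrArg (fun L => L v) (h1.unique h2)

theorem isAngularMode_wirtinger (hF : IsAngularMode n F) {σ : ℤ} (hσ : σ ^ 2 = 1) :
    IsAngularMode (n + σ) (wirtinger σ F) where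
  smooth := (hF.contDiff_fderiv_apply _).add (contDiff_const.mul (hF.contDiff_fderiv_apply _))
  eq_zero p hp := by simp [wirtinger, hF.fderiv_eq_zero hp]
  map_rotation α p := by
    have h1 := hF.fderiv_rotation α p (Real.cos α, -Real.sin α)
    have h2 := hF.fderiv_rotation α p (Real.sin α, Real.cos α)
    have e1 : planeRotation α (Real.cos α, -Real.sin α) = (1, 0) := by
      simp only [planeRotation_apply, Prod.mk.injEq]
      constructor
      · linear_combination Real.sin_sq_add_cos_sq α
      · ring
    have e2 : planeRotation α (Real.sin α, Real.cos α) = (0, 1) := by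
      simp only [planeRotation_apply, Prod.mk.injEq]
      constructor
      · ring
      · linear_combination Real.sin_sq_add_cos_sq α
    have hlin : ∀ a b : ℝ, fderiv ℝ F p (a, b) =
        a * fderiv ℝ F p (1, 0) + b * fderiv ℝ F p (0, 1) := fun a b => by
      have : ((a, b) : ℝ × ℝ) = a • (1, 0) + b • (0, 1) := by simp
      rw [this, map_add, map_smul, map_smul, Complex.real_smul, Complex.real_smul]
    rw [e1, hlin] at h1
    rw [e2, hlin] at h2
    have hexp : Complex.exp (Complex.I * ((n + σ : ℤ) : ℂ) * α) =
        Complex.exp (Complex.I * n * α) * (Complex.cos α + σ * Complex.I * Complex.sin α) := by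
      have : Complex.cos α + σ * Complex.I * Complex.sin α = Complex.exp (σ * α * Complex.I) := by
        rw [Complex.exp_mul_I]
        rcases mul_self_eq_one_iff.1 ((sq σ).symm.trans hσ) with rfl | rfl <;> simp <;> ring
      rw [this, ← Complex.exp_add]
      push_cast
      ring_nf
    have hσ' : (σ : ℂ) ^ 2 = 1 := by exact_mod_cast hσ
    simp only [wirtinger, h1, h2, hexp]
    push_cast
    linear_combination (-Complex.exp (Complex.I * n * α) * Complex.sin α * fderiv ℝ F p (0, 1)) *
      (σ ^ 2 * Complex.I_sq - hσ')

theorem fderiv_snd_axis (hF : IsAngularMode n F) (r : ℝ) :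
    r * fderiv ℝ F (r, 0) (0, 1) = Complex.I * n * F (r, 0) := by
  have hγ : HasDerivAt (fun α : ℝ => planeRotation α (r, 0)) ((0, r) : ℝ × ℝ) 0 := by
    have h := ((Real.hasDerivAt_cos 0).mul_const r).prodMk ((Real.hasDerivAt_sin 0).mul_const r)
    simpa [planeRotation_apply] using h
  have h0 : planeRotation 0 (r, 0) = (r, 0) := by simp [planeRotation_apply]
  have h1 : HasDerivAt (fun α : ℝ => F (planeRotation α (r, 0))) (fderiv ℝ F (r, 0) (0, r)) 0 := by
    have := HasFDerivAt.comp_hasDerivAt (f := fun α : ℝ => planeRotation α (r, 0)) (0 : ℝ)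
      (hF.differentiable (planeRotation 0 (r, 0))).hasFDerivAt hγ
    rwa [h0] at this
  have h2 : HasDerivAt (fun α : ℝ => F (planeRotation α (r, 0))) (Complex.I * n * F (r, 0)) 0 := by
    simp only [hF.map_rotation]
    have h := ((Complex.ofRealCLM.hasDerivAt (x := (0 : ℝ))).const_mul
      (Complex.I * n)).cexp.mul_const (F (r, 0))
    simpa using h
  rw [← h1.unique h2, ← Complex.real_smul, ← map_smul]
  simp

theorem deriv_verticalIntegral_eq_zero (hF : IsAngularMode n F) {s : ℝ} (hs : 1 < s) :
    deriv (verticalIntegral F) s = 0 := by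
  have : ∀ t, fderiv ℝ F (s, t) = 0 :=
    fun t => hF.fderiv_eq_zero (by simp only; nlinarith [sq_nonneg t])
  rw [(hasDerivAt_verticalIntegral hF.smooth s).deriv]
  simp [this]

theorem verticalIntegral_wirtinger (hF : IsAngularMode n F) (σ : ℤ) :
    verticalIntegral (wirtinger σ F) = deriv (verticalIntegral F) := by
  funext s
  have hc : ∀ v, Continuous fun t : ℝ => fderiv ℝ F (s, t) v := fun v =>
    (hF.contDiff_fderiv_apply v).continuous.comp (by fun_prop : Continuous fun t : ℝ => (s, t))
  have hz : ∫ t in (-2 : ℝ)..2, fderiv ℝ F (s, t) (0, 1) = 0 := by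
    rw [intervalIntegral.integral_eq_sub_of_hasDerivAt
      (fun t _ => hasDerivAt_prodMk_snd hF.differentiable s t) ((hc _).intervalIntegrable _ _),
      hF.eq_zero _ (by simp only; nlinarith [sq_nonneg s]),
      hF.eq_zero _ (by simp only; nlinarith [sq_nonneg s]), sub_zero]
  rw [(hasDerivAt_verticalIntegral hF.smooth s).deriv]
  simp only [verticalIntegral, wirtinger]
  rw [intervalIntegral.integral_add ((hc _).intervalIntegrable _ _)
    (((hc _).intervalIntegrable _ _).const_mul _),
    intervalIntegral.integral_const_mul, hz, mul_zero, add_zero]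

end IsAngularMode

/-- Cormack's formula for `F` on the positive half-axis, after the substitution `s = r cosh u`. -/
def CormackFormula (n : ℤ) (F : ℝ × ℝ → ℂ) : Prop :=
  ∀ r M : ℝ, 0 < r → 0 ≤ M → 2 ≤ r * Real.cosh M →
    F (r, 0) = -(1 / (π : ℂ)) * ∫ u in (0 : ℝ)..M,
      deriv (verticalIntegral F) (r * Real.cosh u) * (Real.cosh (n * u) : ℂ)

/-- Solutions of `x y' = m y` on `[a, b]`, `a > 0`, that vanish at `b` vanish at `a`. -/
theorem eq_zero_of_mul_deriv_eq {y y' : ℝ → ℂ} {m : ℤ} {a b : ℝ} (ha : 0 < a) (hab : a ≤ b)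
    (hy : ∀ x ∈ Icc a b, HasDerivAt y (y' x) x) (hy' : ∀ x ∈ Icc a b, x * y' x = m * y x)
    (hb : y b = 0) : y a = 0 := by
  have hz : ∀ x ∈ Icc a b, HasDerivAt (fun x => y x * ((x ^ (-m) : ℝ) : ℂ)) 0 x := by
    intro x hx
    have hx0 : x ≠ 0 := (ha.trans_le hx.1).ne'
    have h := (hy x hx).mul ((hasDerivAt_zpow (-m) x (Or.inl hx0)).ofReal_comp)
    refine h.congr_deriv ?_
    have hx0' : (x : ℂ) ≠ 0 := by exact_mod_cast hx0
    push_cast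
    rw [zpow_sub₀ hx0', zpow_one]
    field_simp
    linear_combination ((x : ℂ) ^ (-m)) * hy' x hx
  have h := constant_of_has_deriv_right_zero
    (fun x hx => (hz x hx).continuousAt.continuousWithinAt)
    (fun x hx => (hz x ⟨hx.1, hx.2.le⟩).hasDerivWithinAt) b (right_mem_Icc.2 hab)
  simp only [hb, zero_mul] at h
  have hne : ((a ^ (-m) : ℝ) : ℂ) ≠ 0 := by exact_mod_cast zpow_ne_zero _ ha.ne'
  exact (mul_eq_zero.1 h.symm).resolve_right hne

theorem IsAngularMode.cormackFormula_of_wirtinger {n : ℤ} {F : ℝ × ℝ → ℂ}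
    (hF : IsAngularMode n F) {σ : ℤ} (hσ : σ ^ 2 = 1)
    (h : CormackFormula (n + σ) (wirtinger σ F)) : CormackFormula n F := by
  intro r M hr hM hrM
  set G := deriv (verticalIntegral F) with hGdef
  have hG : ContDiff ℝ (⊤ : ℕ∞) G := by
    have := contDiff_verticalIntegral (hF.isAngularMode_wirtinger hσ).smooth
    rwa [hF.verticalIntegral_wirtinger] at this
  have hG' : ∀ s, HasDerivAt G (deriv G s) s := fun s =>
    (hG.differentiable (by simp) s).hasDerivAt
  have hG'c : Continuous (deriv G) := hG.continuous_deriv (by simp)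
  have hchn : ∀ u : ℝ, HasDerivAt (fun u : ℝ => (Real.sinh (n * u) : ℂ))
      (n * Real.cosh (n * u) : ℂ) u := fun u => by
    have := (((hasDerivAt_id u).const_mul (n : ℝ)).sinh).ofReal_comp
    simpa [mul_comm] using this
  have hGin : ∀ ρ u : ℝ, HasDerivAt (fun u => G (ρ * Real.cosh u))
      ((ρ * Real.sinh u : ℝ) * deriv G (ρ * Real.cosh u)) u := fun ρ u => by
    have := (hG' (ρ * Real.cosh u)).scomp u ((Real.hasDerivAt_cosh u).const_mul ρ)
    exact this.congr_deriv (by rw [Complex.real_smul])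
  -- the boundary terms of an integration by parts vanish
  have hparts : ∀ ρ, r ≤ ρ → ∫ u in (0 : ℝ)..M,
      ((ρ * Real.sinh u : ℝ) * deriv G (ρ * Real.cosh u) * (Real.sinh (n * u) : ℂ) +
        G (ρ * Real.cosh u) * (n * Real.cosh (n * u) : ℂ)) = 0 := by
    intro ρ hρ
    have hM1 : 1 < ρ * Real.cosh M := by nlinarith [Real.cosh_pos M]
    rw [intervalIntegral.integral_eq_sub_of_hasDerivAt
      (fun u _ => (hGin ρ u).mul (hchn u))
      (Continuous.intervalIntegrable (by fun_prop) _ _)]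
    simp [hGdef, hF.deriv_verticalIntegral_eq_zero hM1]
  have hJ : ∀ ρ, HasDerivAt (fun ρ => ∫ u in (0 : ℝ)..M,
      G (ρ * Real.cosh u) * (Real.cosh (n * u) : ℂ))
      (∫ u in (0 : ℝ)..M, (Real.cosh u : ℂ) * deriv G (ρ * Real.cosh u) *
        (Real.cosh (n * u) : ℂ)) ρ := by
    intro ρ
    refine hasDerivAt_intervalIntegral_of_contDiff
      (K := fun ρ u => G (ρ * Real.cosh u) * (Real.cosh (n * u) : ℂ))
      (K' := fun ρ u => (Real.cosh u : ℂ) * deriv G (ρ * Real.cosh u) *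
        (Real.cosh (n * u) : ℂ)) ?_ (fun x t => ?_) 0 M ρ
    · have h1 : ContDiff ℝ 1 fun p : ℝ × ℝ => G (p.1 * Real.cosh p.2) :=
        (hG.of_le (by simp)).comp (contDiff_fst.mul (Real.contDiff_cosh.comp contDiff_snd))
      have h2 : ContDiff ℝ 1 fun p : ℝ × ℝ => (Real.cosh (n * p.2) : ℂ) :=
        Complex.ofRealCLM.contDiff.comp
          (Real.contDiff_cosh.comp (contDiff_const.mul contDiff_snd))
      exact h1.mul h2
    · have := (hG' (x * Real.cosh t)).scomp x ((hasDerivAt_id x).mul_const (Real.cosh t))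
      simpa [Complex.real_smul] using this.mul_const (Real.cosh (n * t) : ℂ)
  have hode : ∀ ρ, r ≤ ρ →
      ρ * (fderiv ℝ F (ρ, 0) (1, 0) - -(1 / (π : ℂ)) * ∫ u in (0 : ℝ)..M,
        (Real.cosh u : ℂ) * deriv G (ρ * Real.cosh u) * (Real.cosh (n * u) : ℂ)) =
      ((σ * n : ℤ) : ℂ) * (F (ρ, 0) - -(1 / (π : ℂ)) * ∫ u in (0 : ℝ)..M,
        G (ρ * Real.cosh u) * (Real.cosh (n * u) : ℂ)) := by
    intro ρ hρ
    have h1 := h ρ M (hr.trans_le hρ) hM (by nlinarith [Real.cosh_pos M])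
    rw [hF.verticalIntegral_wirtinger, ← hGdef] at h1
    have h2 := hF.fderiv_snd_axis ρ
    have h3 := hparts ρ hρ
    have hcosh : ∀ u : ℝ, (Real.cosh ((n + σ : ℤ) * u) : ℂ) =
        Real.cosh (n * u) * Real.cosh u + σ * (Real.sinh (n * u) * Real.sinh u) := fun u => by
      have : Real.cosh ((n + σ : ℤ) * u) =
          Real.cosh (n * u) * Real.cosh u + σ * (Real.sinh (n * u) * Real.sinh u) := by
        push_cast
        rw [add_mul, Real.cosh_add]
        rcases mul_self_eq_one_iff.1 ((sq σ).symm.trans hσ) with rfl | rfl <;> simp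
      exact_mod_cast this
    rw [intervalIntegral.integral_add (Continuous.intervalIntegrable (by fun_prop) _ _)
      (Continuous.intervalIntegrable (by fun_prop) _ _)] at h3
    have h4 : ρ * ∫ u in (0 : ℝ)..M,
        deriv G (ρ * Real.cosh u) * (Real.cosh ((n + σ : ℤ) * u) : ℂ) =
        ρ * (∫ u in (0 : ℝ)..M,
          (Real.cosh u : ℂ) * deriv G (ρ * Real.cosh u) * (Real.cosh (n * u) : ℂ)) +
        σ * ∫ u in (0 : ℝ)..M,
          (ρ * Real.sinh u : ℝ) * deriv G (ρ * Real.cosh u) * (Real.sinh (n * u) : ℂ) := by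
      rw [← intervalIntegral.integral_const_mul, ← intervalIntegral.integral_const_mul,
        ← intervalIntegral.integral_const_mul,
        ← intervalIntegral.integral_add (Continuous.intervalIntegrable (by fun_prop) _ _)
          (Continuous.intervalIntegrable (by fun_prop) _ _)]
      refine intervalIntegral.integral_congr fun u _ => ?_
      simp only [hcosh]
      push_cast
      ring
    have h5 : ∫ u in (0 : ℝ)..M, G (ρ * Real.cosh u) * (n * Real.cosh (n * u) : ℂ) =
        n * ∫ u in (0 : ℝ)..M, G (ρ * Real.cosh u) * (Real.cosh (n * u) : ℂ) := by
      rw [← intervalIntegral.integral_const_mul]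
      exact intervalIntegral.integral_congr fun u _ => by ring
    rw [h5] at h3
    simp only [wirtinger] at h1
    rw [Int.cast_mul]
    linear_combination ρ * h1 - Complex.I * σ * h2 - (1 / (π : ℂ)) * h4 -
      σ * (1 / (π : ℂ)) * h3 + σ * n * F (ρ, 0) * (-Complex.I_sq)
  refine sub_eq_zero.1 (eq_zero_of_mul_deriv_eq
    (y := fun x => F (x, 0) - -(1 / (π : ℂ)) * ∫ u in (0 : ℝ)..M,
      G (x * Real.cosh u) * (Real.cosh (n * u) : ℂ)) (b := r + 2) hr (by linarith)
    (fun x _ => (hasDerivAt_prodMk_fst hF.differentiable x 0).sub ((hJ x).const_mul _))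
    (fun x hx => hode x hx.1) ?_)
  have hzero : ∀ u, G ((r + 2) * Real.cosh u) = 0 := fun u =>
    hF.deriv_verticalIntegral_eq_zero (by nlinarith [Real.one_le_cosh u])
  simp [hzero, hF.eq_zero (r + 2, 0) (by simp only; nlinarith)]

/-- The integral over the plane of a function of the polar radius. -/
theorem integral_radial (g : ℝ → ℂ) :
    ∫ p : ℝ × ℝ, g (p.1 ^ 2 + p.2 ^ 2) = 2 * π * ∫ ρ in Ioi (0 : ℝ), ρ * g (ρ ^ 2) := by
  rw [← integral_comp_polarCoord_symm, polarCoord_target]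
  have h : ∀ p : ℝ × ℝ, p.1 • g ((polarCoord.symm p).1 ^ 2 + (polarCoord.symm p).2 ^ 2) =
      (p.1 * g (p.1 ^ 2)) * (fun _ : ℝ => (1 : ℂ)) p.2 := fun p => by
    have : (polarCoord.symm p).1 ^ 2 + (polarCoord.symm p).2 ^ 2 = p.1 ^ 2 := by
      simp only [polarCoord_symm_apply]
      linear_combination p.1 ^ 2 * Real.sin_sq_add_cos_sq p.2
    rw [this, Complex.real_smul, mul_one]
  simp only [h]
  rw [Measure.volume_eq_prod, setIntegral_prod_mul (fun x : ℝ => x * g (x ^ 2)) (fun _ => (1 : ℂ))]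
  have : ∫ _ in Ioo (-π) π, (1 : ℂ) = 2 * π := by
    simp [Real.pi_pos.le, two_mul]
  rw [this, mul_comm]

theorem intervalIntegral_even {H : ℝ → ℂ} (hH : Continuous H) (he : ∀ x, H (-x) = H x) (V : ℝ) :
    ∫ x in -V..V, H x = 2 * ∫ x in (0 : ℝ)..V, H x := by
  rw [← intervalIntegral.integral_add_adjacent_intervals (hH.intervalIntegrable (-V) 0)
    (hH.intervalIntegrable 0 V)]
  have := intervalIntegral.integral_comp_neg (a := 0) (b := V) H
  simp only [he, neg_zero] at this
  rw [← this, two_mul]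

theorem IsAngularMode.cormackFormula_zero {F : ℝ × ℝ → ℂ} (hF : IsAngularMode 0 F) :
    CormackFormula 0 F := by
  intro r M hr hM hrM
  have hrot : ∀ α p, F (planeRotation α p) = F p := fun α p => by simp [hF.map_rotation]
  have hradial : ∀ x y : ℝ, F (x, y) = F (√(x ^ 2 + y ^ 2), 0) := fun x y => by
    rw [← hrot (Complex.arg ⟨x, y⟩) (√(x ^ 2 + y ^ 2), 0)]
    have hn : ‖(⟨x, y⟩ : ℂ)‖ = √(x ^ 2 + y ^ 2) := by
      rw [Complex.norm_def, Complex.normSq_apply]; simp only [sq]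
    have h1 := Complex.norm_mul_cos_arg ⟨x, y⟩
    have h2 := Complex.norm_mul_sin_arg ⟨x, y⟩
    rw [hn] at h1 h2
    simp only [planeRotation_apply, mul_zero, sub_zero, add_zero]
    rw [mul_comm, h1, mul_comm, h2]
  set f : ℝ → ℂ := fun x => fderiv ℝ F (x, 0) (1, 0) with hf
  have hfc : Continuous f := (hF.contDiff_fderiv_apply (1, 0)).continuous.comp (by fun_prop)
  have hf0 : ∀ x, 1 < x → f x = 0 := fun x hx => by
    simp [hf, hF.fderiv_eq_zero (p := (x, 0)) (by simp only; nlinarith)]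
  have hfd : ∀ x, HasDerivAt (fun x => F (x, 0)) (f x) x := fun x =>
    hasDerivAt_prodMk_fst hF.differentiable x 0
  have hsqrt : ∀ x y : ℝ, 0 < x ^ 2 + y → HasDerivAt (fun x => √(x ^ 2 + y))
      (x / √(x ^ 2 + y)) x := fun x y hxy => by
    have := (((hasDerivAt_pow 2 x).add_const y).sqrt hxy.ne')
    refine this.congr_deriv ?_
    have := (Real.sqrt_pos.2 hxy).ne'
    field_simp
    simp
  have hcomp : ∀ x y : ℝ, 0 < x ^ 2 + y → HasDerivAt (fun x => F (√(x ^ 2 + y), 0))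
      (x * (f √(x ^ 2 + y) / √(x ^ 2 + y))) x := fun x y hxy => by
    have := (hfd √(x ^ 2 + y)).scomp x (hsqrt x y hxy)
    refine this.congr_deriv ?_
    rw [Complex.real_smul]
    push_cast
    ring
  have hFx : ∀ x y : ℝ, 0 < x → fderiv ℝ F (x, y) (1, 0) =
      x * (f √(x ^ 2 + y ^ 2) / √(x ^ 2 + y ^ 2)) := fun x y hx => by
    have h := hasDerivAt_prodMk_fst hF.differentiable x y
    simp only [hradial _ y] at h
    exact h.unique (hcomp x (y ^ 2) (by positivity))
  set g : ℝ → ℂ := fun w => f √(w + r ^ 2) / √(w + r ^ 2) with hg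
  have hg0 : ∀ w, 1 < w + r ^ 2 → g w = 0 := fun w hw => by
    simp [hg, hf0 _ (Real.lt_sqrt_of_sq_lt (by simpa using hw))]
  set K : ℝ × ℝ → ℂ := fun p => g (p.1 ^ 2 + p.2 ^ 2) with hK
  have hKc : Continuous K := by
    refine Continuous.div (by fun_prop) (by fun_prop) fun p => ?_
    have : 0 < √(p.1 ^ 2 + p.2 ^ 2 + r ^ 2) := Real.sqrt_pos.2 (by positivity)
    exact_mod_cast this.ne'
  have hK0 : ∀ v t : ℝ, 1 < v ^ 2 + t ^ 2 + r ^ 2 → K (v, t) = 0 := fun v t h => hg0 _ h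
  have hKi : Integrable K := by
    refine hKc.integrable_of_hasCompactSupport
      (HasCompactSupport.of_support_subset_isCompact
        ((isCompact_Icc (a := (-1 : ℝ)) (b := 1)).prod (isCompact_Icc (a := (-1 : ℝ)) (b := 1))) ?_)
    rintro ⟨v, t⟩ hvt
    have : v ^ 2 + t ^ 2 + r ^ 2 ≤ 1 := not_lt.1 fun h => hvt (hK0 v t h)
    exact ⟨abs_le.1 ((sq_le_one_iff_abs_le_one v).1 (by nlinarith)),
      abs_le.1 ((sq_le_one_iff_abs_le_one t).1 (by nlinarith))⟩
  set H : ℝ → ℂ := fun v => ∫ t in (-2 : ℝ)..2, K (v, t) with hH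
  have hHc : Continuous H :=
    intervalIntegral.continuous_parametric_intervalIntegral_of_continuous'
      (f := fun v t => K (v, t)) hKc (-2) 2
  have hHe : ∀ v, H (-v) = H v := fun v => by simp [hH, hK]
  -- the slices of the disk `v² + t² ≤ 1 - r²`
  have hVsq : (r * Real.sinh M) ^ 2 = (r * Real.cosh M) ^ 2 - r ^ 2 := by
    rw [mul_pow, Real.sinh_sq]; ring
  have hV0 : 0 ≤ r * Real.sinh M := mul_nonneg hr.le (Real.sinh_nonneg_iff.2 hM)
  have hplane : ∫ p, K p = ∫ v in -(r * Real.sinh M)..(r * Real.sinh M), H v := by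
    rw [Measure.volume_eq_prod, integral_prod K hKi,
      intervalIntegral.integral_eq_integral_of_support_subset]
    · refine integral_congr_ae (.of_forall fun v => ?_)
      refine (intervalIntegral.integral_eq_integral_of_support_subset fun t ht => ?_).symm
      have : v ^ 2 + t ^ 2 + r ^ 2 ≤ 1 := not_lt.1 fun h => ht (hK0 v t h)
      constructor <;> nlinarith
    · intro v hv
      by_contra hv'
      have hv2 : (r * Real.sinh M) ^ 2 ≤ v ^ 2 := by
        rw [mem_Ioc, not_and_or, not_lt, not_le] at hv'
        rcases hv' with h | h <;> nlinarith
      refine hv ?_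
      have : ∀ t, K (v, t) = 0 := fun t => hK0 v t (by nlinarith [sq_nonneg t])
      simp [hH, this]
  have hpolar : ∫ p, K p = -(2 * π * F (r, 0)) := by
    rw [hK, integral_radial]
    have h1 : ∫ ρ in Ioi (0 : ℝ), (ρ : ℂ) * g (ρ ^ 2) = ∫ ρ in (0 : ℝ)..2, (ρ : ℂ) * g (ρ ^ 2) := by
      rw [intervalIntegral.integral_of_le zero_le_two]
      refine (setIntegral_eq_of_subset_of_forall_sdiff_eq_zero measurableSet_Ioi
        Ioc_subset_Ioi_self fun ρ hρ => ?_)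
      have h2 : 2 < ρ := not_le.1 fun h => hρ.2 ⟨hρ.1, h⟩
      rw [hg0 _ (by nlinarith), mul_zero]
    have hgc : Continuous fun ρ : ℝ => (ρ : ℂ) * g (ρ ^ 2) := by
      have : Continuous fun ρ : ℝ => K (ρ, 0) := hKc.comp (by fun_prop)
      simp only [hK, ne_eq, OfNat.ofNat_ne_zero, not_false_eq_true, zero_pow, add_zero] at this
      exact Complex.continuous_ofReal.mul this
    rw [h1, intervalIntegral.integral_eq_sub_of_hasDerivAt
      (fun ρ _ => hcomp ρ (r ^ 2) (by positivity)) (hgc.intervalIntegrable _ _)]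
    have h3 : F (√(2 ^ 2 + r ^ 2), 0) = 0 :=
      hF.eq_zero _ (by simp only; rw [Real.sq_sqrt (by positivity)]; nlinarith)
    have h4 : √((0 : ℝ) ^ 2 + r ^ 2) = r := by simp [Real.sqrt_sq hr.le]
    rw [h3, h4]
    ring
  have hsub : ∫ u in (0 : ℝ)..M, deriv (verticalIntegral F) (r * Real.cosh u) *
      (Real.cosh ((0 : ℤ) * u) : ℂ) = ∫ v in (0 : ℝ)..(r * Real.sinh M), H v := by
    have h := intervalIntegral.integral_deriv_smul_comp (a := 0) (b := M)
      (f := fun u => r * Real.sinh u) (f' := fun u => r * Real.cosh u)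
      (fun u _ => (Real.hasDerivAt_sinh u).const_mul r) (by fun_prop) hHc
    simp only [Real.sinh_zero, mul_zero] at h
    rw [← h]
    refine intervalIntegral.integral_congr fun u _ => ?_
    have hpos : 0 < r * Real.cosh u := mul_pos hr (Real.cosh_pos u)
    simp only [Int.cast_zero, zero_mul, Real.cosh_zero, Complex.ofReal_one, mul_one,
      Function.comp_apply]
    rw [(hasDerivAt_verticalIntegral hF.smooth _).deriv, hH, Complex.real_smul,
      ← intervalIntegral.integral_const_mul]
    refine intervalIntegral.integral_congr fun t _ => ?_
    have : (r * Real.cosh u) ^ 2 + t ^ 2 = (r * Real.sinh u) ^ 2 + t ^ 2 + r ^ 2 := by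
      rw [mul_pow, mul_pow, Real.cosh_sq]; ring
    simp only [hFx _ t hpos, this, hK, hg]
  rw [hsub]
  have h := intervalIntegral_even hHc hHe (r * Real.sinh M)
  rw [← hplane, hpolar] at h
  have hπ : (π : ℂ) ≠ 0 := by exact_mod_cast Real.pi_ne_zero
  field_simp
  linear_combination (-1 / 2) * h

theorem IsAngularMode.cormackFormula {n : ℤ} :
    ∀ {F : ℝ × ℝ → ℂ}, IsAngularMode n F → CormackFormula n F := by
  induction n with
  | zero => exact fun hF => hF.cormackFormula_zero
  | succ k ih =>
    intro F hF
    have hF' := hF.isAngularMode_wirtinger (σ := -1) (by norm_num)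
    refine hF.cormackFormula_of_wirtinger (σ := -1) (by norm_num) ?_
    rw [add_neg_cancel_right] at hF' ⊢
    exact ih hF'
  | pred k ih =>
    intro F hF
    have hF' := hF.isAngularMode_wirtinger (σ := 1) (by norm_num)
    refine hF.cormackFormula_of_wirtinger (σ := 1) (by norm_num) ?_
    rw [sub_add_cancel] at hF' ⊢
    exact ih hF'

/-- The component of angular frequency `n` of a function on the plane. -/
def angularComponent (h : ℝ × ℝ → ℝ) (n : ℤ) (p : ℝ × ℝ) : ℂ :=
  (1 / (2 * (π : ℂ))) * ∫ α in (0 : ℝ)..(2 * π),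
    (h (planeRotation α p) : ℂ) * Complex.exp (-Complex.I * n * α)

theorem contDiff_angularComponent_integrand {h : ℝ × ℝ → ℝ} (hsm : ContDiff ℝ (⊤ : ℕ∞) h)
    (n : ℤ) : ContDiff ℝ (⊤ : ℕ∞) (fun q : (ℝ × ℝ) × ℝ =>
      (h (planeRotation q.2 q.1) : ℂ) * Complex.exp (-Complex.I * n * q.2)) := by
  have h1 : ContDiff ℝ (⊤ : ℕ∞) fun q : (ℝ × ℝ) × ℝ => planeRotation q.2 q.1 := by
    simp only [planeRotation_apply]
    exact ((Real.contDiff_cos.comp contDiff_snd).mul contDiff_fst.fst |>.sub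
      ((Real.contDiff_sin.comp contDiff_snd).mul contDiff_fst.snd)).prodMk
      ((Real.contDiff_sin.comp contDiff_snd).mul contDiff_fst.fst |>.add
      ((Real.contDiff_cos.comp contDiff_snd).mul contDiff_fst.snd))
  have h2 : ContDiff ℝ (⊤ : ℕ∞) fun q : (ℝ × ℝ) × ℝ => (q.2 : ℂ) :=
    Complex.ofRealCLM.contDiff.comp contDiff_snd
  exact (Complex.ofRealCLM.contDiff.comp (hsm.comp h1)).mul (contDiff_const.mul h2).cexp

theorem isAngularMode_angularComponent {h : ℝ × ℝ → ℝ} (hsm : ContDiff ℝ (⊤ : ℕ∞) h)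
    (hsupp : Function.support h ⊆ unitDisk) (n : ℤ) :
    IsAngularMode n (angularComponent h n) where
  smooth := contDiff_const.mul (contDiff_intervalIntegral
    (K := fun p α => (h (planeRotation α p) : ℂ) * Complex.exp (-Complex.I * n * α))
    (contDiff_angularComponent_integrand hsm n) 0 (2 * π))
  eq_zero p hp := by
    have : ∀ α, h (planeRotation α p) = 0 := fun α => by
      by_contra hne
      have h1 := hsupp hne
      simp only [unitDisk, mem_ofPred_eq, planeRotation_norm_sq] at h1
      exact lt_asymm hp h1
    simp [angularComponent, this]
  map_rotation β p := by
    set k : ℝ → ℂ := fun α => (h (planeRotation α p) : ℂ) * Complex.exp (-Complex.I * n * α)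
      with hk
    have hper : Function.Periodic k (2 * π) := fun α => by
      have h1 : Complex.exp (-Complex.I * n * ((α + 2 * π : ℝ) : ℂ)) =
          Complex.exp (-Complex.I * n * α) := by
        rw [Complex.exp_eq_exp_iff_exists_int]
        refine ⟨-n, ?_⟩
        push_cast
        ring
      simp only [hk, h1, planeRotation_apply, Real.cos_add_two_pi, Real.sin_add_two_pi]
    have hshift : ∀ α : ℝ, (h (planeRotation α (planeRotation β p)) : ℂ) *
        Complex.exp (-Complex.I * n * α) = Complex.exp (Complex.I * n * β) * k (α + β) := by
      intro α
      simp only [hk, planeRotation_planeRotation]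
      rw [mul_left_comm, ← Complex.exp_add]
      push_cast
      ring_nf
    simp only [angularComponent, hshift]
    rw [intervalIntegral.integral_const_mul, intervalIntegral.integral_comp_add_right, zero_add,
      add_comm (2 * π) β, hper.intervalIntegral_add_eq β 0, zero_add]
    ring

theorem fourierCoeff'_eq_angularComponent (h : ℝ × ℝ → ℝ) (n : ℤ) (r : ℝ) :
    fourierCoeff' (fun φ => h (r • Phi φ)) n = angularComponent h n (r, 0) := by
  simp only [fourierCoeff', angularComponent, planeRotation_eq_smul_Phi, zero_smul, add_zero]

theorem fourierCoeff'_radon {h : ℝ × ℝ → ℝ} (hc : Continuous h)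
    (hsupp : Function.support h ⊆ unitDisk) (n : ℤ) :
    (fun s => fourierCoeff' (fun φ => radon h s φ) n) =
      verticalIntegral (angularComponent h n) := by
  funext s
  have hradon : ∀ φ, radon h s φ = ∫ t in (-2 : ℝ)..2, h (planeRotation φ (s, t)) := fun φ => by
    simp only [radon, ← planeRotation_eq_smul_Phi]
    refine (intervalIntegral.integral_eq_integral_of_support_subset fun t ht => ?_).symm
    have h1 := hsupp (show h _ ≠ 0 from ht)
    simp only [unitDisk, mem_ofPred_eq, planeRotation_norm_sq] at h1
    constructor <;> nlinarith [sq_nonneg s]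
  have hcont : Continuous (Function.uncurry fun (t α : ℝ) =>
      (h (planeRotation α (s, t)) : ℂ) * Complex.exp (-Complex.I * n * α)) := by
    simp only [planeRotation_apply, Function.uncurry_def]
    fun_prop
  simp only [verticalIntegral, angularComponent, fourierCoeff', hradon]
  rw [intervalIntegral.integral_const_mul, intervalIntegral_intervalIntegral_swap]
  · congr 1
    refine intervalIntegral.integral_congr fun α _ => ?_
    simp only [← intervalIntegral.integral_ofReal, intervalIntegral.integral_mul_const]
  · exact (hcont.continuousOn.integrableOn_compact (isCompact_uIcc.prod isCompact_uIcc)).mono_set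
      (prod_mono uIoc_subset_uIcc uIoc_subset_uIcc)

/-- The substitution `s = r cosh u` in Cormack's integral. -/
theorem integral_comp_cosh_chebyshev (G : ℝ → ℂ) (n : ℤ) {r M : ℝ} (hr : 0 < r) (hM : 0 ≤ M) :
    ∫ s in r..(r * Real.cosh M), G s *
        ((((Polynomial.Chebyshev.T ℝ |n|).eval (s / r)) / √(s ^ 2 - r ^ 2) : ℝ) : ℂ) =
      ∫ u in (0 : ℝ)..M, G (r * Real.cosh u) * (Real.cosh (n * u) : ℂ) := by
  have h := intervalIntegral.integral_deriv_smul_comp_of_deriv_nonneg (a := 0) (b := M)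
    (f := fun u => r * Real.cosh u) (f' := fun u => r * Real.sinh u)
    (g := fun s => G s *
        ((((Polynomial.Chebyshev.T ℝ |n|).eval (s / r)) / √(s ^ 2 - r ^ 2) : ℝ) : ℂ))
    (by fun_prop) (fun u _ => (Real.hasDerivAt_cosh u).const_mul r)
    (fun u hu => mul_nonneg hr.le (Real.sinh_nonneg_iff.2 ((le_min le_rfl hM).trans hu.1.le)))
  simp only [Real.cosh_zero, mul_one] at h
  rw [← h]
  refine intervalIntegral.integral_congr_ae (.of_forall fun u hu => ?_)
  have hu0 : 0 < u := by
    rw [uIoc_of_le hM] at hu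
    exact hu.1
  have hs : 0 < r * Real.sinh u := mul_pos hr (Real.sinh_pos_iff.2 hu0)
  have h1 : √((r * Real.cosh u) ^ 2 - r ^ 2) = r * Real.sinh u := by
    rw [← Real.sqrt_sq hs.le, mul_pow, mul_pow, Real.cosh_sq]
    ring_nf
  have h2 : Real.cosh ((|n| : ℤ) * u) = Real.cosh (n * u) := by
    rcases abs_choice n with h | h <;> simp [h]
  have hs' : ((r * Real.sinh u : ℝ) : ℂ) ≠ 0 := by exact_mod_cast hs.ne'
  rw [Function.comp_apply, mul_div_cancel_left₀ _ hr.ne', Polynomial.Chebyshev.T_real_cosh, h1, h2,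
    Complex.real_smul, Complex.ofReal_div]
  field_simp

/-- Cormack's inversion formula for the Radon transform. -/
theorem cormack_inversion (h : ℝ × ℝ → ℝ) (hsm : ContDiff ℝ (⊤ : ℕ∞) h)
    (hsupp : Function.support h ⊆ unitDisk) (n : ℤ) (r : ℝ) (hr0 : 0 < r) (hr1 : r < 1) :
    fourierCoeff' (fun φ => h (r • Phi φ)) n =
      -(1 / (π : ℂ)) * ∫ s in r..1,
        deriv (fun s' => fourierCoeff' (fun φ => radon h s' φ) n) s *
          ((((Polynomial.Chebyshev.T ℝ |n|).eval (s / r)) / Real.sqrt (s ^ 2 - r ^ 2) : ℝ) : ℂ) := by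
  have hmode := isAngularMode_angularComponent hsm hsupp n
  obtain ⟨M, hM0, hM⟩ : ∃ M, 0 ≤ M ∧ r * Real.cosh M = 2 := by
    have h2 : 1 ≤ 2 / r := by rw [le_div_iff₀ hr0]; linarith
    exact ⟨Real.arcosh (2 / r), Real.arcosh_nonneg h2, by
      rw [Real.cosh_arcosh h2]; field_simp⟩
  rw [fourierCoeff'_eq_angularComponent, fourierCoeff'_radon hsm.continuous hsupp,
    hmode.cormackFormula r M hr0 hM0 hM.ge, ← integral_comp_cosh_chebyshev _ n hr0 hM0, hM,
    intervalIntegral.integral_of_le hr1.le, intervalIntegral.integral_of_le (by linarith)]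
  congr 1
  refine setIntegral_eq_of_subset_of_forall_sdiff_eq_zero measurableSet_Ioc
    (Ioc_subset_Ioc_right one_le_two) fun s hs => ?_
  have h1 : 1 < s := not_le.1 fun h => hs.2 ⟨hs.1.1, h⟩
  rw [hmode.deriv_verticalIntegral_eq_zero h1, zero_mul]
end
end

section
/- Let h : ℝ² → ℝ be a smooth function whose support is contained in the open unit disk 𝔻, let c₁, c₂ be nonzero real constants, and let n be an integer such that c₁ e^{−i n (arcsin s − π/2)} + c₂ e^{i n (arcsin s − π/2)} ≠ 0 for all s ∈ (0, 1). Define g_n(s) := (V_w h)_n(arcsin s) / (c₁ e^{−i n (arcsin s − π/2)} + c₂ e^{i n (arcsin s − π/2)}) for s ∈ (0, 1). Then for every r with 0 < r < 1, h_n(r) = −(1/π) ∫_r^1 g_n'(s) · T_{|n|}(s/r) / √(s² − r²) ds, where T_k denotes the degree-k Chebyshev polynomial of the first kind evaluated as a polynomial at real arguments. -/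
open Real MeasureTheory Set

noncomputable section

lemma hasDerivAt_intervalIntegral_of_continuous {E : Type*} [NormedAddCommGroup E]
    [NormedSpace ℝ E] {f f' : ℝ → ℝ → E} (hf : Continuous (Function.uncurry f))
    (hf' : Continuous (Function.uncurry f')) (hd : ∀ x t, HasDerivAt (fun y => f y t) (f' x t) x)
    (a b x : ℝ) :
    HasDerivAt (fun y => ∫ t in a..b, f y t) (∫ t in a..b, f' x t) x := by
  obtain ⟨C, hC⟩ := ((isCompact_closedBall x 1).prod (isCompact_uIcc (a := a) (b := b))).exists_bound_of_continuousOn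
    hf'.continuousOn
  refine (intervalIntegral.hasDerivAt_integral_of_dominated_loc_of_deriv_le
    (bound := fun _ => C) (Metric.closedBall_mem_nhds x one_pos)
    (Filter.Eventually.of_forall fun y => ?_) ?_ ?_ ?_ ?_ ?_).2
  · exact (hf.comp (Continuous.prodMk_right y)).aestronglyMeasurable
  · exact (hf.comp (Continuous.prodMk_right x)).intervalIntegrable a b
  · exact (hf'.comp (Continuous.prodMk_right x)).aestronglyMeasurable
  · exact Filter.Eventually.of_forall fun t ht y hy => hC (y, t) ⟨hy, uIoc_subset_uIcc ht⟩
  · exact intervalIntegrable_const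
  · exact Filter.Eventually.of_forall fun t _ y _ => hd y t

lemma fourierCoeff'_comp_add {k : ℝ → ℝ} (hk : Function.Periodic k (2 * π)) (n : ℤ) (a : ℝ) :
    fourierCoeff' (fun φ => k (φ + a)) n = Complex.exp (Complex.I * n * a) * fourierCoeff' k n := by
  set q : ℝ → ℂ := fun φ => (k φ : ℂ) * Complex.exp (-Complex.I * n * φ) with hq
  have hper : Function.Periodic q (2 * π) := by
    intro φ
    simp only [hq, hk φ]
    congr 1
    rw [Complex.exp_eq_exp_iff_exists_int]
    exact ⟨-n, by push_cast; ring⟩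
  have h1 : ∀ φ : ℝ, (k (φ + a) : ℂ) * Complex.exp (-Complex.I * n * φ)
      = Complex.exp (Complex.I * n * a) * q (φ + a) := by
    intro φ
    simp only [hq]
    rw [mul_left_comm, ← Complex.exp_add]
    congr 2
    push_cast; ring
  unfold fourierCoeff'
  simp_rw [h1]
  rw [intervalIntegral.integral_const_mul, intervalIntegral.integral_comp_add_right q a,
    add_comm (2 * π) a, zero_add, hper.intervalIntegral_add_eq a 0, zero_add]
  simp only [hq]
  ring

lemma integral_comp_sinh {E : Type*} [NormedAddCommGroup E] [NormedSpace ℝ E] (f : ℝ → E)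
    {c : ℝ} (hc : 0 < c) :
    ∫ u, (c * Real.cosh u) • f (c * Real.sinh u) = ∫ x, f x := by
  have himg : (fun u => c * Real.sinh u) '' univ = univ := by
    rw [image_univ, range_eq_univ]
    intro x
    obtain ⟨u, hu⟩ := Real.sinh_surjective (x / c)
    exact ⟨u, by simp only [hu]; field_simp⟩
  have := integral_image_eq_integral_abs_deriv_smul (s := univ) MeasurableSet.univ
    (f := fun u => c * Real.sinh u) (f' := fun u => c * Real.cosh u)
    (fun x _ => ((Real.hasDerivAt_sinh x).const_mul c).hasDerivWithinAt)
    (fun x _ y _ hxy => Real.sinh_injective (mul_left_cancel₀ hc.ne' hxy)) f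
  rw [himg, setIntegral_univ, setIntegral_univ] at this
  rw [this]
  refine integral_congr_ae (Filter.Eventually.of_forall fun u => ?_)
  simp only [abs_of_pos (mul_pos hc (Real.cosh_pos u))]

lemma setIntegral_Ioi_comp_cosh {E : Type*} [NormedAddCommGroup E] [NormedSpace ℝ E]
    (f : ℝ → E) {r : ℝ} (hr : 0 < r) :
    ∫ s in Ioi r, f s = ∫ u in Ioi (0 : ℝ), (r * Real.sinh u) • f (r * Real.cosh u) := by
  have himg : (fun u => r * Real.cosh u) '' Ioi 0 = Ioi r := by
    ext s
    constructor
    · rintro ⟨u, hu, rfl⟩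
      have := Real.one_lt_cosh.2 (ne_of_gt hu : u ≠ 0)
      exact (lt_mul_iff_one_lt_right hr).2 this
    · intro hs
      have h1 : 1 < s / r := (one_lt_div hr).2 hs
      refine ⟨Real.arcosh (s / r), Real.arcosh_pos h1, ?_⟩
      simp only [Real.cosh_arcosh h1.le]
      field_simp
  rw [← himg, integral_image_eq_integral_abs_deriv_smul measurableSet_Ioi
    (f' := fun u => r * Real.sinh u)
    (fun x _ => ((Real.hasDerivAt_cosh x).const_mul r).hasDerivWithinAt)]
  · refine setIntegral_congr_fun measurableSet_Ioi fun u hu => ?_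
    simp only [abs_of_pos (mul_pos hr (Real.sinh_pos_iff.2 hu))]
  · intro x hx y hy hxy
    exact Real.cosh_strictMonoOn.injOn (mem_Ici_of_Ioi hx) (mem_Ici_of_Ioi hy)
      (mul_left_cancel₀ hr.ne' hxy)

/-- The mean over a circle inside the unit disk of the powers of the Cayley transform is one. -/
lemma integral_cayley_zpow (n : ℤ) {q : ℝ} (hq : |q| < 1) :
    ∫ η in (-π)..π, ((1 + q * Complex.exp (η * Complex.I)) /
      (1 - q * Complex.exp (η * Complex.I))) ^ n = 2 * π := by
  have hne : ∀ w : ℂ, ‖w‖ < 1 → 1 + w ≠ 0 ∧ 1 - w ≠ 0 := by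
    intro w hw
    refine ⟨fun h => ?_, fun h => ?_⟩
    · rw [← neg_eq_of_add_eq_zero_right h] at hw; simp at hw
    · rw [← sub_eq_zero.1 h] at hw; simp at hw
  have hd : DifferentiableOn ℂ (fun w : ℂ => ((1 + w) / (1 - w)) ^ n) (Metric.ball 0 1) := by
    intro w hw
    obtain ⟨h1, h2⟩ := hne w (by simpa using hw)
    refine DifferentiableAt.differentiableWithinAt ?_
    exact DifferentiableAt.zpow (by fun_prop (disch := assumption))
      (Or.inl (div_ne_zero h1 h2))
  have hcl : DiffContOnCl ℂ (fun w : ℂ => ((1 + w) / (1 - w)) ^ n) (Metric.ball 0 |q|) := by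
    refine DifferentiableOn.diffContOnCl (hd.mono fun w hw => ?_)
    have := Metric.closure_ball_subset_closedBall hw
    simp at this ⊢
    linarith
  have key := hcl.circleAverage
  rw [circleAverage_def] at key
  simp only [circleMap, zero_add, add_zero, sub_zero, div_one, one_zpow] at key
  set k : ℝ → ℂ := fun η => ((1 + q * Complex.exp (η * Complex.I)) /
      (1 - q * Complex.exp (η * Complex.I))) ^ n with hk
  have hper : Function.Periodic k (2 * π) := by
    intro η
    simp only [hk]
    have : Complex.exp (((η + 2 * π : ℝ) : ℂ) * Complex.I) = Complex.exp (η * Complex.I) := by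
      rw [Complex.exp_eq_exp_iff_exists_int]
      exact ⟨1, by push_cast; ring⟩
    rw [this]
  have h2 := hper.intervalIntegral_add_eq (-π) 0
  rw [show -π + 2 * π = π by ring, zero_add] at h2
  rw [h2]
  have hpi : ((2 * π : ℝ)) ≠ 0 := by positivity
  have := congrArg (fun z => (2 * π : ℝ) • z) key
  simp only [smul_smul, mul_inv_cancel₀ hpi, one_smul] at this
  rw [this]
  simp

lemma cosh_mul_sqrt_eq {u τ : ℝ} :
    Real.cosh u * √(1 + τ ^ 2) = √(1 + (√(1 + τ ^ 2) * Real.sinh u) ^ 2 + τ ^ 2) := by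
  symm
  rw [Real.sqrt_eq_iff_mul_self_eq (by positivity)
    (mul_nonneg (Real.cosh_pos u).le (Real.sqrt_nonneg _))]
  have h1 := Real.sq_sqrt (show 0 ≤ 1 + τ ^ 2 by positivity)
  have h2 := Real.cosh_sq u
  linear_combination -h1 - √(1 + τ ^ 2) ^ 2 * h2

lemma abs_lt_cosh (u : ℝ) : |u| < Real.cosh u := by
  have h1 : |u| ≤ Real.sinh |u| := Real.self_le_sinh_iff.2 (abs_nonneg u)
  have h2 := Real.sinh_lt_cosh |u|
  rw [Real.cosh_abs] at h2
  linarith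

lemma exp_arctan_mul_I (τ : ℝ) :
    Complex.exp (Complex.I * (Real.arctan τ : ℝ)) = (1 + Complex.I * τ) / (√(1 + τ ^ 2) : ℝ) := by
  rw [mul_comm, Complex.exp_mul_I, ← Complex.ofReal_cos, ← Complex.ofReal_sin, Real.cos_arctan,
    Real.sin_arctan]
  push_cast
  ring

lemma exp_add_arctan_mul_I_eq (u τ : ℝ) :
    Complex.exp (u + Complex.I * (Real.arctan τ : ℝ)) =
      ((√(1 + τ ^ 2) * Real.sinh u + √(1 + (√(1 + τ ^ 2) * Real.sinh u) ^ 2 + τ ^ 2) : ℝ) : ℂ) /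
        (1 - Complex.I * τ) := by
  rw [← cosh_mul_sqrt_eq, Complex.exp_add, exp_arctan_mul_I, ← Complex.ofReal_exp,
    ← Real.cosh_add_sinh u]
  have h1 : ((√(1 + τ ^ 2) : ℝ) : ℂ) ^ 2 = 1 + (τ : ℂ) ^ 2 := by
    rw [← Complex.ofReal_pow, Real.sq_sqrt (by positivity)]; push_cast; ring
  have h2 : ((√(1 + τ ^ 2) : ℝ) : ℂ) ≠ 0 := by
    exact_mod_cast (Real.sqrt_pos.2 (by positivity : 0 < 1 + τ ^ 2)).ne'
  have h3 : (1 - Complex.I * τ) ≠ 0 := by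
    intro h; simpa using congrArg Complex.re h
  field_simp
  push_cast
  linear_combination (-(Complex.cosh u + Complex.sinh u) * τ ^ 2) * Complex.I_sq -
    (Complex.cosh u + Complex.sinh u) * h1

lemma polar_eq_cayley {σ : ℝ} (η : ℝ) :
    ((σ * Real.cos η + √(1 + σ ^ 2) : ℝ) : ℂ) / (1 - Complex.I * ((σ * Real.sin η : ℝ) : ℂ)) =
      (1 + ((σ / (1 + √(1 + σ ^ 2)) : ℝ) : ℂ) * Complex.exp (η * Complex.I)) /
      (1 - ((σ / (1 + √(1 + σ ^ 2)) : ℝ) : ℂ) * Complex.exp (η * Complex.I)) := by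
  have hC := Real.sq_sqrt (show 0 ≤ 1 + σ ^ 2 by positivity)
  have hC1 : 0 < √(1 + σ ^ 2) := Real.sqrt_pos.2 (by positivity)
  set C := √(1 + σ ^ 2)
  obtain ⟨q, hq⟩ : ∃ q, q = σ / (1 + C) := ⟨_, rfl⟩
  have hqσ : σ = q * (1 + C) := by rw [hq]; field_simp
  have hqC : q * σ = C - 1 := by
    rw [hq]; field_simp; linarith
  rw [← hq]
  have hq1 : q ^ 2 < 1 := by
    have : q ^ 2 * (1 + C) = C - 1 := by rw [← hqC]; conv_rhs => rw [hqσ]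
                                         ring
    nlinarith
  have h3 : (1 - Complex.I * ((σ * Real.sin η : ℝ) : ℂ)) ≠ 0 := by
    intro h; simpa [Complex.sin_ofReal_re, Complex.sin_ofReal_im] using congrArg Complex.re h
  have h4 : (1 - (q : ℂ) * Complex.exp (η * Complex.I)) ≠ 0 := by
    intro h
    have h5 := congrArg norm (sub_eq_zero.1 h)
    rw [norm_mul, Complex.norm_exp_ofReal_mul_I, Complex.norm_real] at h5
    simp at h5
    have := sq_abs q
    rw [← h5] at this
    linarith
  rw [div_eq_div_iff h3 h4, Complex.exp_mul_I, ← Complex.ofReal_cos, ← Complex.ofReal_sin]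
  have hcs := Real.sin_sq_add_cos_sq η
  apply Complex.ext
  · simp [Complex.cos_ofReal_re, Complex.sin_ofReal_re, Complex.cos_ofReal_im, Complex.sin_ofReal_im]
    linear_combination Real.cos η * hqσ - hqC - q * σ * hcs
  · simp [Complex.cos_ofReal_re, Complex.sin_ofReal_re, Complex.cos_ofReal_im, Complex.sin_ofReal_im]
    linear_combination Real.sin η * hqσ

lemma setIntegral_Ioi_comp_sqrt (f : ℝ → ℂ) {r : ℝ} (hr : 0 < r) :
    ∫ s in Ioi r, f s =
      ∫ σ in Ioi (0 : ℝ), (r * (σ / √(1 + σ ^ 2))) • f (r * √(1 + σ ^ 2)) := by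
  have hpos : ∀ σ : ℝ, 0 < √(1 + σ ^ 2) := fun σ => Real.sqrt_pos.2 (by positivity)
  have himg : (fun σ => r * √(1 + σ ^ 2)) '' Ioi 0 = Ioi r := by
    ext s
    constructor
    · rintro ⟨u, hu, rfl⟩
      have : 1 < √(1 + u ^ 2) := by
        rw [Real.lt_sqrt (by norm_num)]; have := pow_pos (mem_Ioi.1 hu) 2; linarith
      exact (lt_mul_iff_one_lt_right hr).2 this
    · intro hs
      have h1 : 1 < s / r := (one_lt_div hr).2 hs
      refine ⟨√((s / r) ^ 2 - 1), Real.sqrt_pos.2 (by nlinarith), ?_⟩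
      have h2 : (0 : ℝ) ≤ (s / r) ^ 2 - 1 := by nlinarith
      simp only [Real.sq_sqrt h2, add_sub_cancel]
      rw [Real.sqrt_sq (by linarith)]
      field_simp
  have hd : ∀ σ : ℝ, HasDerivAt (fun σ => r * √(1 + σ ^ 2)) (r * (σ / √(1 + σ ^ 2))) σ := by
    intro σ
    have := (((hasDerivAt_pow 2 σ).const_add 1).sqrt (by positivity)).const_mul r
    rwa [show r * (((2 : ℕ) : ℝ) * σ ^ (2 - 1) / (2 * √(1 + σ ^ 2))) = r * (σ / √(1 + σ ^ 2)) by
      norm_num [mul_div_mul_left]] at this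
  rw [← himg, integral_image_eq_integral_abs_deriv_smul measurableSet_Ioi
    (fun x _ => (hd x).hasDerivWithinAt)]
  · refine setIntegral_congr_fun measurableSet_Ioi fun u hu => ?_
    rw [abs_of_pos (mul_pos hr (div_pos hu (hpos u)))]
  · intro x hx y hy hxy
    have h1 := mul_left_cancel₀ hr.ne' hxy
    rw [Real.sqrt_inj (by positivity) (by positivity)] at h1
    exact (sq_eq_sq₀ (le_of_lt hx) (le_of_lt hy)).1 (by linarith)

lemma lt_inv_of_support {f : ℝ → ℂ} (hf0 : ∀ ρ, 1 ≤ ρ → f ρ = 0) {r a : ℝ} (hr : 0 < r)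
    (ha : f (r * a) ≠ 0) : a < r⁻¹ := by
  by_contra! h
  refine ha (hf0 _ ?_)
  have := mul_le_mul_of_nonneg_left h hr.le
  rwa [mul_inv_cancel₀ hr.ne'] at this

lemma abs_le_sqrt_one_add_sq (τ : ℝ) : |τ| ≤ √(1 + τ ^ 2) :=
  Real.abs_le_sqrt (by linarith)

lemma one_le_sqrt_one_add_sq (τ : ℝ) : 1 ≤ √(1 + τ ^ 2) :=
  Real.le_sqrt_of_sq_le (by nlinarith [sq_nonneg τ])

/-- The radial part of a function on the plane, integrated against the kernel coming from the
composition of Cormack's two transforms. -/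
lemma integral_plane_kernel {f : ℝ → ℂ} (hf : Continuous f) (hf0 : ∀ ρ, 1 ≤ ρ → f ρ = 0) (n : ℤ)
    {r : ℝ} (hr : 0 < r) :
    r * ∫ p : ℝ × ℝ, f (r * √(1 + p.1 ^ 2 + p.2 ^ 2)) / (√(1 + p.1 ^ 2 + p.2 ^ 2) : ℝ) *
        (((p.1 + √(1 + p.1 ^ 2 + p.2 ^ 2) : ℝ) : ℂ) / (1 - Complex.I * p.2)) ^ n =
      2 * π * ∫ ρ in Ioi r, f ρ := by
  rw [← integral_comp_polarCoord_symm]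
  have hsq : ∀ σ η : ℝ, 1 + (σ * Real.cos η) ^ 2 + (σ * Real.sin η) ^ 2 = 1 + σ ^ 2 := by
    intro σ η
    linear_combination σ ^ 2 * Real.sin_sq_add_cos_sq η
  have hpos : ∀ σ : ℝ, 0 < √(1 + σ ^ 2) := fun σ => Real.sqrt_pos.2 (by positivity)
  simp only [polarCoord_symm_apply, hsq, polar_eq_cayley]
  have hq : ∀ σ : ℝ, |σ / (1 + √(1 + σ ^ 2))| < 1 := by
    intro σ
    have := hpos σ
    rw [abs_div, abs_of_pos (by linarith : 0 < 1 + √(1 + σ ^ 2)), div_lt_one (by linarith)]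
    linarith [abs_le_sqrt_one_add_sq σ]
  have hne : ∀ (q η : ℝ), |q| < 1 → 1 + (q : ℂ) * Complex.exp (η * Complex.I) ≠ 0 ∧
      1 - (q : ℂ) * Complex.exp (η * Complex.I) ≠ 0 := by
    intro q η hq
    have hn : ‖(q : ℂ) * Complex.exp (η * Complex.I)‖ < 1 := by
      rwa [norm_mul, Complex.norm_exp_ofReal_mul_I, Complex.norm_real, mul_one]
    refine ⟨fun h => ?_, fun h => ?_⟩
    · rw [← neg_eq_of_add_eq_zero_right h] at hn; simp at hn
    · rw [← sub_eq_zero.1 h] at hn; simp at hn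
  have hint : IntegrableOn (fun p : ℝ × ℝ => p.1 • (f (r * √(1 + p.1 ^ 2)) / (√(1 + p.1 ^ 2) : ℝ) *
      ((1 + ((p.1 / (1 + √(1 + p.1 ^ 2)) : ℝ) : ℂ) * Complex.exp (p.2 * Complex.I)) /
      (1 - ((p.1 / (1 + √(1 + p.1 ^ 2)) : ℝ) : ℂ) * Complex.exp (p.2 * Complex.I))) ^ n))
      (Ioi 0 ×ˢ Ioo (-π) π) := by
    have hcont : Continuous (fun p : ℝ × ℝ => p.1 • (f (r * √(1 + p.1 ^ 2)) / (√(1 + p.1 ^ 2) : ℝ) *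
      ((1 + ((p.1 / (1 + √(1 + p.1 ^ 2)) : ℝ) : ℂ) * Complex.exp (p.2 * Complex.I)) /
      (1 - ((p.1 / (1 + √(1 + p.1 ^ 2)) : ℝ) : ℂ) * Complex.exp (p.2 * Complex.I))) ^ n)) := by
      have h1 : Continuous fun p : ℝ × ℝ => p.1 / (1 + √(1 + p.1 ^ 2)) :=
        continuous_fst.div (by fun_prop) fun p => by have := hpos p.1; positivity
      have h2 : Continuous fun p : ℝ × ℝ =>
          ((p.1 / (1 + √(1 + p.1 ^ 2)) : ℝ) : ℂ) * Complex.exp (p.2 * Complex.I) :=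
        (Complex.continuous_ofReal.comp h1).mul (by fun_prop)
      have h3 : Continuous fun p : ℝ × ℝ => f (r * √(1 + p.1 ^ 2)) := by fun_prop
      have h4 : Continuous fun p : ℝ × ℝ => ((√(1 + p.1 ^ 2) : ℝ) : ℂ) := by fun_prop
      have h5 := (continuous_const (y := (1 : ℂ))).add h2
      have h6 := (continuous_const (y := (1 : ℂ))).sub h2
      exact continuous_fst.smul ((h3.div h4 fun p => Complex.ofReal_ne_zero.2 (hpos p.1).ne').mul
        ((h5.div h6 fun p => (hne _ _ (hq p.1)).2).zpow₀ n fun p =>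
          Or.inl (div_ne_zero (hne _ _ (hq p.1)).1 (hne _ _ (hq p.1)).2)))
    refine IntegrableOn.of_forall_sdiff_eq_zero (hcont.continuousOn.integrableOn_compact
      ((isCompact_Icc (a := 0) (b := r⁻¹)).prod (isCompact_Icc (a := -π) (b := π))))
      (measurableSet_Ioi.prod measurableSet_Ioo) ?_
    rintro ⟨σ, η⟩ ⟨⟨hσ, hη⟩, hn⟩
    simp only [mem_Ioi] at hσ
    have : f (r * √(1 + σ ^ 2)) = 0 := by
      by_contra h
      have h1 := lt_inv_of_support hf0 hr h
      have h2 := (le_abs_self σ).trans (abs_le_sqrt_one_add_sq σ)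
      exact hn ⟨⟨hσ.le, by linarith⟩, Ioo_subset_Icc_self hη⟩
    simp [this]
  rw [polarCoord_target, Measure.volume_eq_prod, setIntegral_prod _ hint, setIntegral_Ioi_comp_sqrt f hr,
    ← integral_const_mul, ← integral_const_mul]
  refine setIntegral_congr_fun measurableSet_Ioi fun σ _ => ?_
  simp only [Complex.real_smul]
  rw [integral_const_mul, integral_const_mul, ← integral_Ioc_eq_integral_Ioo,
    ← intervalIntegral.integral_of_le (by linarith [Real.pi_pos]), integral_cayley_zpow n (hq σ)]
  push_cast
  ring

lemma integral_strip_kernel {f : ℝ → ℂ} (hf : Continuous f) (hf0 : ∀ ρ, 1 ≤ ρ → f ρ = 0) (n : ℤ)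
    {r : ℝ} (hr : 0 < r) :
    r * ∫ u : ℝ, ∫ τ : ℝ, f (r * (Real.cosh u * √(1 + τ ^ 2))) *
        Complex.exp (n * (u + Complex.I * (Real.arctan τ : ℝ))) =
      2 * π * ∫ ρ in Ioi r, f ρ := by
  have hc1 : Continuous (Function.uncurry fun u τ : ℝ => f (r * (Real.cosh u * √(1 + τ ^ 2))) *
        Complex.exp (n * (u + Complex.I * (Real.arctan τ : ℝ)))) := by
    have := Real.continuous_arctan
    have := Real.continuous_cosh
    simp only [Function.uncurry_def]
    fun_prop
  rw [integral_integral_swap_of_hasCompactSupport hc1]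
  swap
  · refine HasCompactSupport.intro ((isCompact_Icc (a := -r⁻¹) (b := r⁻¹)).prod
      (isCompact_Icc (a := -r⁻¹) (b := r⁻¹))) ?_
    rintro ⟨u, τ⟩ hn
    simp only [Function.uncurry_apply_pair, mul_eq_zero]
    left
    by_contra h
    have h1 := lt_inv_of_support hf0 hr h
    refine hn ⟨abs_le.1 ?_, abs_le.1 ?_⟩
    · have := abs_lt_cosh u
      have := le_mul_of_one_le_right (Real.cosh_pos u).le (one_le_sqrt_one_add_sq τ)
      simp only; linarith
    · have := abs_le_sqrt_one_add_sq τ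
      have := le_mul_of_one_le_left (Real.sqrt_nonneg (1 + τ ^ 2)) (Real.one_le_cosh u)
      simp only; linarith
  rw [← integral_plane_kernel hf hf0 n hr]
  have hpos : ∀ x τ : ℝ, 0 < √(1 + x ^ 2 + τ ^ 2) := fun x τ => Real.sqrt_pos.2 (by positivity)
  have hne1 : ∀ x τ : ℝ, 0 < x + √(1 + x ^ 2 + τ ^ 2) := by
    intro x τ
    have : |x| < √(1 + x ^ 2 + τ ^ 2) := by
      rw [← Real.sqrt_sq_eq_abs]
      exact Real.sqrt_lt_sqrt (by positivity) (by nlinarith [sq_nonneg τ])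
    linarith [neg_abs_le x]
  have hne2 : ∀ τ : ℝ, 1 - Complex.I * (τ : ℂ) ≠ 0 := by
    intro τ h; simpa using congrArg Complex.re h
  have hc2 : Continuous fun p : ℝ × ℝ => f (r * √(1 + p.1 ^ 2 + p.2 ^ 2)) /
      (√(1 + p.1 ^ 2 + p.2 ^ 2) : ℝ) *
        (((p.1 + √(1 + p.1 ^ 2 + p.2 ^ 2) : ℝ) : ℂ) / (1 - Complex.I * p.2)) ^ n := by
    have h3 : Continuous fun p : ℝ × ℝ => f (r * √(1 + p.1 ^ 2 + p.2 ^ 2)) := by fun_prop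
    have h4 : Continuous fun p : ℝ × ℝ => ((√(1 + p.1 ^ 2 + p.2 ^ 2) : ℝ) : ℂ) := by fun_prop
    have h5 : Continuous fun p : ℝ × ℝ => ((p.1 + √(1 + p.1 ^ 2 + p.2 ^ 2) : ℝ) : ℂ) := by
      fun_prop
    have h6 : Continuous fun p : ℝ × ℝ => 1 - Complex.I * (p.2 : ℂ) := by fun_prop
    exact (h3.div h4 fun p => Complex.ofReal_ne_zero.2 (hpos p.1 p.2).ne').mul
      ((h5.div h6 fun p => hne2 p.2).zpow₀ n fun p =>
        Or.inl (div_ne_zero (Complex.ofReal_ne_zero.2 (hne1 p.1 p.2).ne') (hne2 p.2)))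
  have hs2 : HasCompactSupport fun p : ℝ × ℝ => f (r * √(1 + p.1 ^ 2 + p.2 ^ 2)) /
      (√(1 + p.1 ^ 2 + p.2 ^ 2) : ℝ) *
        (((p.1 + √(1 + p.1 ^ 2 + p.2 ^ 2) : ℝ) : ℂ) / (1 - Complex.I * p.2)) ^ n := by
    refine HasCompactSupport.intro ((isCompact_Icc (a := -r⁻¹) (b := r⁻¹)).prod
      (isCompact_Icc (a := -r⁻¹) (b := r⁻¹))) ?_
    rintro ⟨x, τ⟩ hn
    suffices h : f (r * √(1 + x ^ 2 + τ ^ 2)) = 0 by simp [h]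
    by_contra h
    have h1 := lt_inv_of_support hf0 hr h
    refine hn ⟨abs_le.1 ?_, abs_le.1 ?_⟩
    · have : |x| ≤ √(1 + x ^ 2 + τ ^ 2) := Real.abs_le_sqrt (by nlinarith [sq_nonneg τ])
      simp only; linarith
    · have : |τ| ≤ √(1 + x ^ 2 + τ ^ 2) := Real.abs_le_sqrt (by nlinarith [sq_nonneg x])
      simp only; linarith
  rw [Measure.volume_eq_prod, integral_prod_symm _
    (by rw [← Measure.volume_eq_prod]; exact hc2.integrable_of_hasCompactSupport hs2)]
  congr 1
  refine integral_congr_ae (Filter.Eventually.of_forall fun τ => ?_)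
  have hcτ : 0 < √(1 + τ ^ 2) := Real.sqrt_pos.2 (by positivity)
  simp only
  conv_rhs => rw [← integral_comp_sinh _ hcτ]
  refine integral_congr_ae (Filter.Eventually.of_forall fun u => ?_)
  simp only
  rw [Complex.exp_int_mul, exp_add_arctan_mul_I_eq, ← cosh_mul_sqrt_eq, mul_comm (√(1 + τ ^ 2)) (Real.cosh u)]
  have h0 : ((Real.cosh u * √(1 + τ ^ 2) : ℝ) : ℂ) ≠ 0 := by
    exact_mod_cast (mul_pos (Real.cosh_pos u) hcτ).ne'
  rw [Complex.real_smul]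
  field_simp

lemma smul_Phi_add_smul_Phi (s t θ : ℝ) :
    s • Phi θ + t • Phi (θ + π / 2) =
      (s * Real.cos θ - t * Real.sin θ, s * Real.sin θ + t * Real.cos θ) := by
  simp only [Phi, Real.cos_add_pi_div_two, Real.sin_add_pi_div_two, Prod.smul_mk, smul_eq_mul,
    Prod.mk_add_mk]
  congr 1
  ring

lemma line_eq_zero {h : ℝ × ℝ → ℝ} (hz : ∀ x : ℝ × ℝ, 1 ≤ x.1 ^ 2 + x.2 ^ 2 → h x = 0)
    {s t : ℝ} (hst : 1 ≤ s ^ 2 + t ^ 2) (θ : ℝ) :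
    h (s • Phi θ + t • Phi (θ + π / 2)) = 0 := by
  rw [smul_Phi_add_smul_Phi]
  refine hz _ ?_
  have := Real.sin_sq_add_cos_sq θ
  calc 1 ≤ s ^ 2 + t ^ 2 := hst
    _ = _ := by linear_combination (-s ^ 2 - t ^ 2) * this

lemma radon_eq_intervalIntegral {h : ℝ × ℝ → ℝ}
    (hz : ∀ x : ℝ × ℝ, 1 ≤ x.1 ^ 2 + x.2 ^ 2 → h x = 0) (s θ : ℝ) :
    radon h s θ = ∫ t in (-1 : ℝ)..1, h (s • Phi θ + t • Phi (θ + π / 2)) := by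
  symm
  apply intervalIntegral.integral_eq_integral_of_support_subset
  intro t ht
  by_contra hn
  refine ht (line_eq_zero hz ?_ θ)
  have : 1 ≤ |t| := by
    by_contra! h1
    rw [abs_lt] at h1
    exact hn ⟨h1.1, h1.2.le⟩
  have h2 := one_le_sq_iff_one_le_abs t |>.2 this
  nlinarith [sq_nonneg s]

lemma radon_eq_zero {h : ℝ × ℝ → ℝ}
    (hz : ∀ x : ℝ × ℝ, 1 ≤ x.1 ^ 2 + x.2 ^ 2 → h x = 0) {s : ℝ} (hs : 1 ≤ s) (θ : ℝ) :
    radon h s θ = 0 := by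
  unfold radon
  have : ∀ t : ℝ, h (s • Phi θ + t • Phi (θ + π / 2)) = 0 := fun t =>
    line_eq_zero hz (by nlinarith [sq_nonneg t]) θ
  simp [this]

lemma continuous_radon_s4 {h : ℝ × ℝ → ℝ} (hc : Continuous h)
    (hz : ∀ x : ℝ × ℝ, 1 ≤ x.1 ^ 2 + x.2 ^ 2 → h x = 0) :
    Continuous (Function.uncurry (radon h)) := by
  have := continuous_Phi
  have h1 : Continuous fun p : ℝ × ℝ =>
      ∫ t in (-1 : ℝ)..1, h (p.1 • Phi p.2 + t • Phi (p.2 + π / 2)) :=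
    intervalIntegral.continuous_parametric_intervalIntegral_of_continuous'
      (by simp only [Function.uncurry_def]; fun_prop) _ _
  convert h1 using 2 with p
  exact radon_eq_intervalIntegral hz p.1 p.2

lemma exists_hasDerivAt_fourierCoeff'_radon {h : ℝ × ℝ → ℝ} (hsm : ContDiff ℝ 1 h)
    (hz : ∀ x : ℝ × ℝ, 1 ≤ x.1 ^ 2 + x.2 ^ 2 → h x = 0) (n : ℤ) :
    ∃ G' : ℝ → ℂ, Continuous G' ∧
      ∀ s, HasDerivAt (fun s => fourierCoeff' (radon h s) n) (G' s) s := by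
  have hPhi := continuous_Phi
  have hfd := hsm.continuous_fderiv one_ne_zero
  set R' : ℝ → ℝ → ℝ := fun s θ =>
    ∫ t in (-1 : ℝ)..1, fderiv ℝ h (s • Phi θ + t • Phi (θ + π / 2)) (Phi θ) with hR'
  have hR'c : Continuous (Function.uncurry R') := by
    refine intervalIntegral.continuous_parametric_intervalIntegral_of_continuous'
      (f := fun (p : ℝ × ℝ) t => fderiv ℝ h (p.1 • Phi p.2 + t • Phi (p.2 + π / 2)) (Phi p.2)) ?_ _ _
    simp only [Function.uncurry_def]
    exact Continuous.clm_apply (by fun_prop) (by fun_prop)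
  have hR : ∀ s θ, HasDerivAt (fun s => radon h s θ) (R' s θ) s := by
    intro s θ
    simp only [radon_eq_intervalIntegral hz]
    refine hasDerivAt_intervalIntegral_of_continuous
      (f := fun s t => h (s • Phi θ + t • Phi (θ + π / 2)))
      (f' := fun s t => fderiv ℝ h (s • Phi θ + t • Phi (θ + π / 2)) (Phi θ)) ?_ ?_ ?_ _ _ _
    · have := hsm.continuous
      simp only [Function.uncurry_def]; fun_prop
    · simp only [Function.uncurry_def]
      exact Continuous.clm_apply (by fun_prop) (by fun_prop)
    · intro s t
      have h1 : HasDerivAt (fun s : ℝ => s • Phi θ + t • Phi (θ + π / 2)) (Phi θ) s := by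
        simpa using ((hasDerivAt_id s).smul_const (Phi θ)).add_const (t • Phi (θ + π / 2))
      exact ((hsm.differentiable one_ne_zero) _).hasFDerivAt.comp_hasDerivAt s h1
  have hRc := continuous_radon_s4 hsm.continuous hz
  have hc' : Continuous (Function.uncurry fun s (θ : ℝ) =>
      (R' s θ : ℂ) * Complex.exp (-Complex.I * n * θ)) := by
    have : Continuous fun p : ℝ × ℝ => R' p.1 p.2 := hR'c
    simp only [Function.uncurry_def]; fun_prop
  refine ⟨fun s => (1 / (2 * (π : ℂ))) * ∫ θ in (0 : ℝ)..(2 * π),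
    (R' s θ : ℂ) * Complex.exp (-Complex.I * n * θ), ?_, fun s => ?_⟩
  · exact continuous_const.mul
      (intervalIntegral.continuous_parametric_intervalIntegral_of_continuous' hc' _ _)
  · refine HasDerivAt.const_mul _ (hasDerivAt_intervalIntegral_of_continuous
      (f := fun s θ => (radon h s θ : ℂ) * Complex.exp (-Complex.I * n * θ)) ?_ hc' ?_ _ _ _)
    · have : Continuous fun p : ℝ × ℝ => radon h p.1 p.2 := hRc
      simp only [Function.uncurry_def]; fun_prop
    · exact fun s θ => (hR s θ).ofReal_comp.mul_const _

lemma Phi_add_two_pi (θ : ℝ) : Phi (θ + 2 * π) = Phi θ := by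
  simp [Phi]

lemma radon_eq_integral_arctan (h : ℝ × ℝ → ℝ) {s : ℝ} (hs : 0 < s) (θ : ℝ) :
    radon h s θ = s * ∫ τ : ℝ, h ((s * √(1 + τ ^ 2)) • Phi (θ + Real.arctan τ)) := by
  have h1 : ∀ τ : ℝ, (s * √(1 + τ ^ 2)) • Phi (θ + Real.arctan τ) =
      s • Phi θ + (s * τ) • Phi (θ + π / 2) := by
    intro τ
    have : √(1 + τ ^ 2) ≠ 0 := (Real.sqrt_pos.2 (by positivity)).ne'
    rw [smul_Phi_add_smul_Phi]
    simp only [Phi, Real.cos_add, Real.sin_add, Real.cos_arctan, Real.sin_arctan, Prod.smul_mk,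
      smul_eq_mul]
    congr 1 <;> field_simp
  simp_rw [h1]
  rw [Measure.integral_comp_mul_left (fun t => h (s • Phi θ + t • Phi (θ + π / 2))) s,
    abs_of_pos (inv_pos.2 hs), smul_eq_mul, mul_inv_cancel_left₀ hs.ne']
  rfl

lemma fourierCoeff'_radon_eq {h : ℝ × ℝ → ℝ} (hc : Continuous h)
    (hz : ∀ x : ℝ × ℝ, 1 ≤ x.1 ^ 2 + x.2 ^ 2 → h x = 0) (n : ℤ) {s : ℝ} (hs : 0 < s) :
    fourierCoeff' (radon h s) n = s * ∫ τ : ℝ,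
      fourierCoeff' (fun φ => h ((s * √(1 + τ ^ 2)) • Phi φ)) n *
        Complex.exp (Complex.I * n * (Real.arctan τ : ℝ)) := by
  have hPhi := continuous_Phi
  have hat := Real.continuous_arctan
  have hper : ∀ ρ : ℝ, Function.Periodic (fun φ => h (ρ • Phi φ)) (2 * π) := by
    intro ρ φ; simp only [Phi_add_two_pi]
  have h1 : ∀ τ : ℝ, fourierCoeff' (fun φ => h ((s * √(1 + τ ^ 2)) • Phi φ)) n *
        Complex.exp (Complex.I * n * (Real.arctan τ : ℝ)) =
      fourierCoeff' (fun φ => h ((s * √(1 + τ ^ 2)) • Phi (φ + Real.arctan τ))) n := by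
    intro τ
    rw [fourierCoeff'_comp_add (hper _), mul_comm]
  simp_rw [h1]
  unfold fourierCoeff'
  rw [integral_const_mul, mul_left_comm]
  congr 1
  simp_rw [radon_eq_integral_arctan h hs]
  have hcont : Continuous (Function.uncurry fun (θ τ : ℝ) =>
      (h ((s * √(1 + τ ^ 2)) • Phi (θ + Real.arctan τ)) : ℂ) *
        Complex.exp (-Complex.I * n * θ)) := by
    simp only [Function.uncurry_def]; fun_prop
  rw [← intervalIntegral_integral_swap, ← intervalIntegral.integral_const_mul]
  · refine intervalIntegral.integral_congr fun θ _ => ?_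
    simp only [integral_mul_const, Complex.ofReal_mul, integral_complex_ofReal]
    ring
  · rw [← Measure.restrict_univ (μ := (volume : Measure ℝ)), Measure.restrict_restrict_of_subset
      (subset_univ _), Measure.prod_restrict]
    refine IntegrableOn.of_forall_sdiff_eq_zero (hcont.continuousOn.integrableOn_compact
      ((isCompact_uIcc (a := 0) (b := 2 * π)).prod (isCompact_Icc (a := -s⁻¹) (b := s⁻¹))))
      (measurableSet_uIoc.prod MeasurableSet.univ) ?_
    rintro ⟨θ, τ⟩ ⟨⟨hθ, -⟩, hn⟩
    have hτ : s⁻¹ < |τ| := by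
      by_contra! hle
      exact hn ⟨uIoc_subset_uIcc hθ, abs_le.1 hle⟩
    have h2 : 1 < s * |τ| := by
      have := mul_lt_mul_of_pos_left hτ hs
      rwa [mul_inv_cancel₀ hs.ne'] at this
    have h3 : h ((s * √(1 + τ ^ 2)) • Phi (θ + Real.arctan τ)) = 0 := by
      refine hz _ ?_
      simp only [Phi, Prod.smul_mk, smul_eq_mul]
      have e := Real.sin_sq_add_cos_sq (θ + Real.arctan τ)
      have e2 := Real.sq_sqrt (show 0 ≤ 1 + τ ^ 2 by positivity)
      have : (s * √(1 + τ ^ 2) * Real.cos (θ + Real.arctan τ)) ^ 2 +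
          (s * √(1 + τ ^ 2) * Real.sin (θ + Real.arctan τ)) ^ 2 = s ^ 2 + (s * |τ|) ^ 2 := by
        rw [mul_pow s |τ|, sq_abs]
        linear_combination (s ^ 2 * √(1 + τ ^ 2) ^ 2) * e + s ^ 2 * e2
      rw [this]
      nlinarith [sq_nonneg s]
    simp [Function.uncurry, h3]

lemma ray_sub_eq_radon {h : ℝ × ℝ → ℝ}
    (hz : ∀ x : ℝ × ℝ, 1 ≤ x.1 ^ 2 + x.2 ^ 2 → h x = 0) {ψ : ℝ} (hψ : 0 ≤ Real.cos ψ) (φ : ℝ) :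
    ∫ t in Ioi (0 : ℝ), h (Phi φ + t • Phi (π + φ - ψ)) =
      radon h (Real.sin ψ) (φ + -(ψ - π / 2)) := by
  have hcs := Real.sin_sq_add_cos_sq ψ
  have h1 : ∀ t : ℝ, Phi φ + t • Phi (π + φ - ψ) =
      Real.sin ψ • Phi (φ + -(ψ - π / 2)) +
        (t - Real.cos ψ) • Phi (φ + -(ψ - π / 2) + π / 2) := by
    intro t
    rw [show φ + -(ψ - π / 2) + π / 2 = π + φ - ψ by ring,
      show φ + -(ψ - π / 2) = (φ - ψ) + π / 2 by ring,
      show π + φ - ψ = (φ - ψ) + π by ring]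
    simp only [Phi, Real.cos_add_pi_div_two, Real.sin_add_pi_div_two, Real.cos_add_pi,
      Real.sin_add_pi, Prod.smul_mk, smul_eq_mul, Prod.mk_add_mk, Real.cos_sub, Real.sin_sub]
    congr 1
    · linear_combination (-Real.cos φ) * hcs
    · linear_combination (-Real.sin φ) * hcs
  simp_rw [h1]
  rw [setIntegral_eq_integral_of_forall_compl_eq_zero]
  · exact integral_sub_right_eq_self (fun t => h (Real.sin ψ • Phi (φ + -(ψ - π / 2)) +
        t • Phi (φ + -(ψ - π / 2) + π / 2))) (Real.cos ψ)
  · intro t ht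
    rw [mem_Ioi, not_lt] at ht
    exact line_eq_zero hz (by nlinarith) _

lemma ray_add_eq_radon {h : ℝ × ℝ → ℝ}
    (hz : ∀ x : ℝ × ℝ, 1 ≤ x.1 ^ 2 + x.2 ^ 2 → h x = 0) {ψ : ℝ} (hψ : 0 ≤ Real.cos ψ) (φ : ℝ) :
    ∫ t in Ioi (0 : ℝ), h (Phi φ + t • Phi (π + φ + ψ)) =
      radon h (Real.sin ψ) (φ + (ψ - π / 2)) := by
  have hcs := Real.sin_sq_add_cos_sq ψ
  have h1 : ∀ t : ℝ, Phi φ + t • Phi (π + φ + ψ) =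
      Real.sin ψ • Phi (φ + (ψ - π / 2)) +
        (Real.cos ψ - t) • Phi (φ + (ψ - π / 2) + π / 2) := by
    intro t
    rw [show φ + (ψ - π / 2) + π / 2 = φ + ψ by ring,
      show φ + (ψ - π / 2) = (φ + ψ) - π / 2 by ring,
      show π + φ + ψ = (φ + ψ) + π by ring]
    simp only [Phi, Real.cos_sub_pi_div_two, Real.sin_sub_pi_div_two,
      Prod.smul_mk, smul_eq_mul, Prod.mk_add_mk, Real.cos_add, Real.sin_add, Real.cos_pi,
      Real.sin_pi]
    congr 1
    · linear_combination (-Real.cos φ) * hcs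
    · linear_combination (-Real.sin φ) * hcs
  simp_rw [h1]
  rw [setIntegral_eq_integral_of_forall_compl_eq_zero]
  · exact integral_sub_left_eq_self (fun t => h (Real.sin ψ • Phi (φ + (ψ - π / 2)) +
        t • Phi (φ + (ψ - π / 2) + π / 2))) volume (Real.cos ψ)
  · intro t ht
    rw [mem_Ioi, not_lt] at ht
    exact line_eq_zero hz (by nlinarith) _

lemma fourierCoeff'_const_mul_add {k₁ k₂ : ℝ → ℝ} (hk₁ : Continuous k₁) (hk₂ : Continuous k₂)
    (c₁ c₂ : ℝ) (n : ℤ) :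
    fourierCoeff' (fun φ => c₁ * k₁ φ + c₂ * k₂ φ) n =
      c₁ * fourierCoeff' k₁ n + c₂ * fourierCoeff' k₂ n := by
  unfold fourierCoeff'
  have h1 : ∀ φ : ℝ, ((c₁ * k₁ φ + c₂ * k₂ φ : ℝ) : ℂ) * Complex.exp (-Complex.I * n * φ) =
      c₁ * (k₁ φ * Complex.exp (-Complex.I * n * φ)) +
        c₂ * (k₂ φ * Complex.exp (-Complex.I * n * φ)) := by
    intro φ; push_cast; ring
  simp_rw [h1]
  rw [intervalIntegral.integral_add, intervalIntegral.integral_const_mul,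
    intervalIntegral.integral_const_mul]
  · ring
  · exact Continuous.intervalIntegrable (by fun_prop) _ _
  · exact Continuous.intervalIntegrable (by fun_prop) _ _

lemma fourierCoeff'_Vw_eq {h : ℝ × ℝ → ℝ} (hc : Continuous h)
    (hz : ∀ x : ℝ × ℝ, 1 ≤ x.1 ^ 2 + x.2 ^ 2 → h x = 0) (c₁ c₂ : ℝ) (n : ℤ) {s : ℝ}
    (hs : s ∈ Ioo (0 : ℝ) 1) :
    fourierCoeff' (fun φ => Vw c₁ c₂ h φ (Real.arcsin s)) n =
      ((c₁ : ℂ) * Complex.exp (-Complex.I * n * ((Real.arcsin s - π / 2 : ℝ) : ℂ)) +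
        (c₂ : ℂ) * Complex.exp (Complex.I * n * ((Real.arcsin s - π / 2 : ℝ) : ℂ))) *
      fourierCoeff' (radon h s) n := by
  have hR : Continuous (radon h s) := (continuous_radon_s4 hc hz).comp (Continuous.prodMk_right s)
  have hcos := Real.cos_arcsin_nonneg s
  simp only [Vw, ray_sub_eq_radon hz hcos, ray_add_eq_radon hz hcos,
    Real.sin_arcsin (by linarith [hs.1] : -1 ≤ s) hs.2.le]
  rw [fourierCoeff'_const_mul_add (k₁ := fun φ => radon h s (φ + -(Real.arcsin s - π / 2)))
    (k₂ := fun φ => radon h s (φ + (Real.arcsin s - π / 2))) (by fun_prop) (by fun_prop),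
    fourierCoeff'_comp_add (radon_periodic h s), fourierCoeff'_comp_add (radon_periodic h s)]
  push_cast
  rw [show Complex.I * n * -((Real.arcsin s : ℂ) - π / 2) =
    -Complex.I * n * ((Real.arcsin s : ℂ) - π / 2) by ring]
  ring

lemma continuous_fourierCoeff'_smul_Phi {h : ℝ × ℝ → ℝ} (hc : Continuous h) (n : ℤ) :
    Continuous fun ρ : ℝ => fourierCoeff' (fun φ => h (ρ • Phi φ)) n := by
  have hPhi := continuous_Phi
  unfold fourierCoeff'
  refine continuous_const.mul
    (intervalIntegral.continuous_parametric_intervalIntegral_of_continuous' ?_ _ _)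
  simp only [Function.uncurry_def]
  fun_prop

lemma fourierCoeff'_smul_Phi_eq_zero {h : ℝ × ℝ → ℝ}
    (hz : ∀ x : ℝ × ℝ, 1 ≤ x.1 ^ 2 + x.2 ^ 2 → h x = 0) (n : ℤ) {ρ : ℝ} (hρ : 1 ≤ ρ) :
    fourierCoeff' (fun φ => h (ρ • Phi φ)) n = 0 := by
  have h1 : ∀ φ, h (ρ • Phi φ) = 0 := by
    intro φ
    have := line_eq_zero hz (s := ρ) (t := 0) (by nlinarith) φ
    simpa using this
  simp [fourierCoeff', h1]

lemma integral_even_mul_exp {k : ℝ → ℂ} (hk : ∀ u, k (-u) = k u) (n : ℤ)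
    (hint : Integrable fun u : ℝ => k u * Complex.exp (n * u)) :
    ∫ u : ℝ, k u * Complex.exp (n * u) =
      2 * ∫ u in Ioi (0 : ℝ), k u * (Real.cosh (n * u) : ℝ) := by
  have hneg : Integrable fun u : ℝ => k u * Complex.exp (-(n * u)) := by
    have := hint.comp_neg
    simp only [hk] at this
    simpa using this
  rw [← intervalIntegral.integral_Iic_add_Ioi (b := 0) hint.integrableOn hint.integrableOn,
    ← neg_zero, ← integral_comp_neg_Ioi, neg_zero, ← integral_const_mul]
  simp only [hk]
  rw [← integral_add]
  · refine integral_congr_ae (Filter.Eventually.of_forall fun u => ?_)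
    simp only [Complex.ofReal_neg, mul_neg, Complex.ofReal_cosh, Complex.ofReal_mul,
      Complex.ofReal_intCast, Complex.cosh]
    ring
  · simpa using hneg.restrict (s := Ioi 0)
  · exact hint.integrableOn

lemma integral_chebyshev_eq {k : ℝ → ℂ} (hk : Continuous k) (hk0 : ∀ s, 1 < s → k s = 0) (n : ℤ)
    {r : ℝ} (hr0 : 0 < r) (hr1 : r < 1) :
    2 * ∫ s in r..1, k s *
        ((((Polynomial.Chebyshev.T ℝ |n|).eval (s / r)) / √(s ^ 2 - r ^ 2) : ℝ) : ℂ) =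
      ∫ u : ℝ, k (r * Real.cosh u) * Complex.exp (n * u) := by
  rw [integral_even_mul_exp (k := fun u => k (r * Real.cosh u)) (by simp)]
  · congr 1
    rw [intervalIntegral.integral_of_le hr1.le,
      ← setIntegral_eq_of_subset_of_forall_sdiff_eq_zero (t := Ioi r) measurableSet_Ioi
        Ioc_subset_Ioi_self,
      setIntegral_Ioi_comp_cosh _ hr0]
    · refine setIntegral_congr_fun measurableSet_Ioi fun u hu => ?_
      have hsinh : 0 < Real.sinh u := Real.sinh_pos_iff.2 hu
      have h1 : √((r * Real.cosh u) ^ 2 - r ^ 2) = r * Real.sinh u := by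
        rw [mul_pow, Real.cosh_sq, show r ^ 2 * (Real.sinh u ^ 2 + 1) - r ^ 2 =
          (r * Real.sinh u) ^ 2 by ring, Real.sqrt_sq (by positivity)]
      have h2 : Real.cosh ((|n| : ℤ) * u) = Real.cosh (n * u) := by
        rcases abs_choice n with h | h <;> rw [h]
        rw [Int.cast_neg, neg_mul, Real.cosh_neg]
      have h3 : ((r * Real.sinh u : ℝ) : ℂ) ≠ 0 :=
        Complex.ofReal_ne_zero.2 (mul_pos hr0 hsinh).ne'
      simp only [h1, mul_div_cancel_left₀ _ hr0.ne', Polynomial.Chebyshev.T_real_cosh, h2,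
        Complex.real_smul, Complex.ofReal_div]
      field_simp
    · intro s hs
      have : 1 < s := by
        by_contra! h
        exact hs.2 ⟨hs.1, h⟩
      rw [hk0 s this, zero_mul]
  · refine Continuous.integrable_of_hasCompactSupport
      (by have := Real.continuous_cosh; fun_prop) ?_
    refine HasCompactSupport.intro (isCompact_Icc (a := -r⁻¹) (b := r⁻¹)) fun u hu => ?_
    rw [hk0, zero_mul]
    have h1 : r⁻¹ < |u| := by
      by_contra! h
      exact hu (abs_le.1 h)
    have := mul_lt_mul_of_pos_left (h1.trans (abs_lt_cosh u)) hr0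
    rwa [mul_inv_cancel₀ hr0.ne'] at this

lemma hasDerivAt_integral_comp_cosh {G G' : ℝ → ℂ} (hG' : Continuous G')
    (hd : ∀ s, HasDerivAt G (G' s) s) (hG0 : ∀ s, 1 ≤ s → G s = 0)
    (hG'0 : ∀ s, 1 < s → G' s = 0) (n : ℤ) {r : ℝ} (hr : 0 < r) :
    HasDerivAt (fun ρ : ℝ => ∫ u : ℝ, G (ρ * Real.cosh u) / (Real.cosh u : ℝ) *
        Complex.exp (n * u))
      (∫ u : ℝ, G' (r * Real.cosh u) * Complex.exp (n * u)) r := by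
  have hG : Continuous G := continuous_iff_continuousAt.2 fun s => (hd s).continuousAt
  have hcosh := Real.continuous_cosh
  have hcosh0 : ∀ u : ℝ, ((Real.cosh u : ℝ) : ℂ) ≠ 0 := fun u =>
    Complex.ofReal_ne_zero.2 (Real.cosh_pos u).ne'
  have hout : ∀ {u : ℝ}, u ∉ Ioc (-(2 / r)) (2 / r) → 2 / r < Real.cosh u := by
    intro u hu
    refine lt_of_le_of_lt ?_ (abs_lt_cosh u)
    by_contra! h
    rw [abs_lt] at h
    exact hu ⟨h.1, h.2.le⟩
  have hder : HasDerivAt (fun ρ : ℝ => ∫ u in (-(2 / r))..(2 / r),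
      G (ρ * Real.cosh u) / (Real.cosh u : ℝ) * Complex.exp (n * u))
      (∫ u in (-(2 / r))..(2 / r), G' (r * Real.cosh u) * Complex.exp (n * u)) r := by
    refine hasDerivAt_intervalIntegral_of_continuous
      (f := fun ρ u => G (ρ * Real.cosh u) / (Real.cosh u : ℝ) * Complex.exp (n * u))
      (f' := fun ρ u => G' (ρ * Real.cosh u) * Complex.exp (n * u)) ?_ ?_ ?_ _ _ _
    · simp only [Function.uncurry_def]
      exact Continuous.mul (Continuous.div (by fun_prop) (by fun_prop) fun p => hcosh0 _)
        (by fun_prop)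
    · simp only [Function.uncurry_def]
      fun_prop
    · intro ρ u
      have h1 : HasDerivAt (fun ρ => G (ρ * Real.cosh u))
          (Real.cosh u • G' (ρ * Real.cosh u)) ρ :=
        (hd (ρ * Real.cosh u)).scomp ρ (by simpa using (hasDerivAt_id ρ).mul_const (Real.cosh u))
      have h2 := (h1.div_const ((Real.cosh u : ℝ) : ℂ)).mul_const (Complex.exp (n * u))
      rwa [Complex.real_smul, mul_div_cancel_left₀ _ (hcosh0 u)] at h2
  rw [intervalIntegral.integral_eq_integral_of_support_subset] at hder
  · refine hder.congr_of_eventuallyEq ?_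
    filter_upwards [lt_mem_nhds (half_lt_self hr)] with ρ hρ
    symm
    apply intervalIntegral.integral_eq_integral_of_support_subset
    intro u hu
    by_contra hn
    refine hu ?_
    have h1 : r / 2 * (2 / r) ≤ ρ * Real.cosh u :=
      mul_le_mul hρ.le (hout hn).le (by positivity) ((half_pos hr).trans hρ).le
    rw [div_mul_div_cancel₀ two_ne_zero, div_self hr.ne'] at h1
    simp only [hG0 _ h1, zero_div, zero_mul]
  · intro u hu
    by_contra hn
    refine hu ?_
    have h1 := mul_lt_mul_of_pos_left (hout hn) hr
    rw [mul_div_cancel₀ _ hr.ne'] at h1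
    simp only [hG'0 (r * Real.cosh u) (by linarith), zero_mul]

lemma integral_fourierCoeff'_radon_cosh {h : ℝ × ℝ → ℝ} (hc : Continuous h)
    (hz : ∀ x : ℝ × ℝ, 1 ≤ x.1 ^ 2 + x.2 ^ 2 → h x = 0) (n : ℤ) {r : ℝ} (hr : 0 < r) :
    ∫ u : ℝ, fourierCoeff' (radon h (r * Real.cosh u)) n / (Real.cosh u : ℝ) *
        Complex.exp (n * u) =
      2 * π * ∫ ρ in Ioi r, fourierCoeff' (fun φ => h (ρ • Phi φ)) n := by
  rw [← integral_strip_kernel (f := fun ρ => fourierCoeff' (fun φ => h (ρ • Phi φ)) n)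
    (continuous_fourierCoeff'_smul_Phi hc n) (fun ρ => fourierCoeff'_smul_Phi_eq_zero hz n) n hr,
    ← integral_const_mul]
  refine integral_congr_ae (Filter.Eventually.of_forall fun u => ?_)
  have hcosh0 : ((Real.cosh u : ℝ) : ℂ) ≠ 0 := Complex.ofReal_ne_zero.2 (Real.cosh_pos u).ne'
  simp only
  rw [fourierCoeff'_radon_eq hc hz n (mul_pos hr (Real.cosh_pos u))]
  simp only [mul_add, Complex.exp_add, ← mul_assoc]
  simp_rw [mul_right_comm _ (Complex.exp (n * u))]
  rw [integral_mul_const]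
  simp_rw [mul_comm (n : ℂ) Complex.I]
  push_cast
  push_cast at hcosh0
  field_simp

/-- Cormack's inversion formula for the angular harmonics of the Radon transform. -/
lemma fourierCoeff'_eq_integral_radon {h : ℝ × ℝ → ℝ} (hc : Continuous h)
    (hz : ∀ x : ℝ × ℝ, 1 ≤ x.1 ^ 2 + x.2 ^ 2 → h x = 0) (n : ℤ) {G' : ℝ → ℂ}
    (hG' : Continuous G') (hd : ∀ s, HasDerivAt (fun s => fourierCoeff' (radon h s) n) (G' s) s)
    {r : ℝ} (hr0 : 0 < r) (hr1 : r < 1) :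
    fourierCoeff' (fun φ => h (r • Phi φ)) n =
      -(1 / (π : ℂ)) * ∫ s in r..1, G' s *
        ((((Polynomial.Chebyshev.T ℝ |n|).eval (s / r)) / √(s ^ 2 - r ^ 2) : ℝ) : ℂ) := by
  have hG0 : ∀ s, 1 ≤ s → fourierCoeff' (radon h s) n = 0 := by
    intro s hs
    simp [fourierCoeff', radon_eq_zero hz hs]
  have hG'0 : ∀ s, 1 < s → G' s = 0 := by
    intro s hs
    refine (hd s).unique ((hasDerivAt_const s (0 : ℂ)).congr_of_eventuallyEq ?_)
    filter_upwards [lt_mem_nhds hs] with t ht using hG0 t ht.le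
  have hd1 := hasDerivAt_integral_comp_cosh hG' hd hG0 hG'0 n hr0
  have hf := continuous_fourierCoeff'_smul_Phi hc n
  have hd2 : HasDerivAt (fun ρ : ℝ => ∫ u : ℝ,
      fourierCoeff' (radon h (ρ * Real.cosh u)) n / (Real.cosh u : ℝ) * Complex.exp (n * u))
      (2 * π * -fourierCoeff' (fun φ => h (r • Phi φ)) n) r := by
    refine ((intervalIntegral.integral_hasDerivAt_left (hf.intervalIntegrable r 1)
      (hf.stronglyMeasurableAtFilter _ _) hf.continuousAt).const_mul
        (2 * π : ℂ)).congr_of_eventuallyEq ?_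
    filter_upwards [lt_mem_nhds hr0, gt_mem_nhds hr1] with ρ hρ0 hρ1
    rw [integral_fourierCoeff'_radon_cosh hc hz n hρ0, intervalIntegral.integral_of_le hρ1.le,
      setIntegral_eq_of_subset_of_forall_sdiff_eq_zero measurableSet_Ioi Ioc_subset_Ioi_self]
    intro s hs
    refine fourierCoeff'_smul_Phi_eq_zero hz n ?_
    by_contra! h
    exact hs.2 ⟨hs.1, h.le⟩
  have hkey := hd1.unique hd2
  rw [← integral_chebyshev_eq hG' hG'0 n hr0 hr1] at hkey
  have hpi : (π : ℂ) ≠ 0 := Complex.ofReal_ne_zero.2 Real.pi_ne_zero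
  rw [show (∫ s in r..1, G' s * ((((Polynomial.Chebyshev.T ℝ |n|).eval (s / r)) /
    √(s ^ 2 - r ^ 2) : ℝ) : ℂ)) = -(π * fourierCoeff' (fun φ => h (r • Phi φ)) n) by
      linear_combination hkey / 2]
  field_simp

/-- Cormack-type inversion of the weighted V-line transform. -/
theorem weighted_Vline_cormack_inversion (h : ℝ × ℝ → ℝ) (hsm : ContDiff ℝ (⊤ : ℕ∞) h)
    (hsupp : Function.support h ⊆ unitDisk) (c₁ c₂ : ℝ) (hc₁ : c₁ ≠ 0) (hc₂ : c₂ ≠ 0)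
    (n : ℤ)
    (hden : ∀ s ∈ Ioo (0 : ℝ) 1,
      (c₁ : ℂ) * Complex.exp (-Complex.I * n * ((Real.arcsin s - π / 2 : ℝ) : ℂ)) +
        (c₂ : ℂ) * Complex.exp (Complex.I * n * ((Real.arcsin s - π / 2 : ℝ) : ℂ)) ≠ 0)
    (g : ℝ → ℂ)
    (hg : ∀ s ∈ Ioo (0 : ℝ) 1,
      g s = fourierCoeff' (fun φ => Vw c₁ c₂ h φ (Real.arcsin s)) n /
        ((c₁ : ℂ) * Complex.exp (-Complex.I * n * ((Real.arcsin s - π / 2 : ℝ) : ℂ)) +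
          (c₂ : ℂ) * Complex.exp (Complex.I * n * ((Real.arcsin s - π / 2 : ℝ) : ℂ))))
    (r : ℝ) (hr0 : 0 < r) (hr1 : r < 1) :
    fourierCoeff' (fun φ => h (r • Phi φ)) n =
      -(1 / (π : ℂ)) * ∫ s in r..1,
        deriv g s *
          ((((Polynomial.Chebyshev.T ℝ |n|).eval (s / r)) / Real.sqrt (s ^ 2 - r ^ 2) : ℝ) : ℂ) := by
  have hz : ∀ x : ℝ × ℝ, 1 ≤ x.1 ^ 2 + x.2 ^ 2 → h x = 0 := by
    intro x hx
    by_contra hne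
    exact absurd (hsupp (Function.mem_support.2 hne)) (not_lt.2 hx)
  have hc := hsm.continuous
  obtain ⟨G', hG', hd⟩ :=
    exists_hasDerivAt_fourierCoeff'_radon (hsm.of_le (by exact_mod_cast le_top)) hz n
  rw [fourierCoeff'_eq_integral_radon hc hz n hG' hd hr0 hr1]
  congr 1
  rw [intervalIntegral.integral_of_le hr1.le, intervalIntegral.integral_of_le hr1.le,
    integral_Ioc_eq_integral_Ioo, integral_Ioc_eq_integral_Ioo]
  refine setIntegral_congr_fun measurableSet_Ioo fun s hs => ?_
  have hgs : deriv g s = G' s := by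
    refine ((hd s).congr_of_eventuallyEq ?_).deriv
    filter_upwards [Ioo_mem_nhds (hr0.trans hs.1) hs.2] with t ht
    rw [hg t ht, fourierCoeff'_Vw_eq hc hz c₁ c₂ n ht, mul_div_cancel_left₀ _ (hden t ht)]
  simp only [hgs]
end
end
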